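/- Let d ≥ 1 and let I : C²_b(ℝ^d) → C_b(ℝ^d) be Lipschitz with constant K₀, satisfy the global comparison property, satisfy the locality assumption, and in addition satisfy the equicontinuity assumption: for every compact (in norm) subset 𝒦 of C²_b(ℝ^d), the family of functions x ↦ ( I(v+u)(x) − I(v)(x) ) / ‖u‖_{C²}, indexed by u, v ∈ 𝒦 with u ≠ 0, is equicontinuous on ℝ^d. Then there exists a family ℒ of bounded linear operators from C²_b(ℝ^d) to C_b(ℝ^d) such that: (i) for every L ∈ ℒ and every x ∈ ℝ^d, the linear functional w ↦ L(w)(x) is a Lévy-type functional based at x; (ii) for all u, v ∈ C²_b(ℝ^d) and all x ∈ ℝ^d there exists L ∈ ℒ with I(u)(x) ≤ I(v)(x) + L(u−v)(x); and consequently (iii) for every u ∈ C²_b(ℝ^d) and x ∈ ℝ^d, I(u)(x) = inf over v ∈ C²_b(ℝ^d) of the sup over L ∈ ℒ of ( I(v)(x) + L(u−v)(x) ), the infimum being attained at v = u. -/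

import Mathlib

open MeasureTheory Metric Filter Set

noncomputable section

abbrev Euc (d : ℕ) := EuclideanSpace ℝ (Fin d)

variable {d : ℕ}

def supNorm (u : Euc d → ℝ) : ℝ := ⨆ x, |u x|

def gradSup (u : Euc d → ℝ) : ℝ := ⨆ x, ‖fderiv ℝ u x‖

def hessSup (u : Euc d → ℝ) : ℝ := ⨆ x, ‖iteratedFDeriv ℝ 2 u x‖

def C2Norm (u : Euc d → ℝ) : ℝ := supNorm u + gradSup u + hessSup u

def IsC2b (u : Euc d → ℝ) : Prop :=
  ContDiff ℝ 2 u ∧ ∃ M : ℝ, ∀ x, |u x| ≤ M ∧ ‖fderiv ℝ u x‖ ≤ M ∧ ‖iteratedFDeriv ℝ 2 u x‖ ≤ M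

def IsCb (f : Euc d → ℝ) : Prop := Continuous f ∧ ∃ M : ℝ, ∀ x, |f x| ≤ M

def GCP (dom : (Euc d → ℝ) → Prop) (I : (Euc d → ℝ) → Euc d → ℝ) : Prop :=
  ∀ u v, dom u → dom v → (∀ y, u y ≤ v y) → ∀ x, u x = v x → I u x ≤ I v x

def LipWith (K₀ : ℝ) (dom : (Euc d → ℝ) → Prop) (N : (Euc d → ℝ) → ℝ)
    (I : (Euc d → ℝ) → Euc d → ℝ) : Prop :=
  ∀ u v, dom u → dom v → ∀ x, |I u x - I v x| ≤ K₀ * N (fun y => u y - v y)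

def localSup (r : ℝ) (u : Euc d → ℝ) : ℝ := ⨆ x ∈ closedBall (0 : Euc d) r, |u x|

def localGradSup (r : ℝ) (u : Euc d → ℝ) : ℝ :=
  ⨆ x ∈ closedBall (0 : Euc d) r, ‖fderiv ℝ u x‖

def localHessSup (r : ℝ) (u : Euc d → ℝ) : ℝ :=
  ⨆ x ∈ closedBall (0 : Euc d) r, ‖iteratedFDeriv ℝ 2 u x‖

def localC2Norm (r : ℝ) (u : Euc d → ℝ) : ℝ := localSup r u + localGradSup r u + localHessSup r u

def Locality (dom : (Euc d → ℝ) → Prop) (locN : ℝ → (Euc d → ℝ) → ℝ)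
    (I : (Euc d → ℝ) → Euc d → ℝ) : Prop :=
  ∃ C₀ : ℝ, ∃ ω : ℝ → ℝ, (∀ r > (0 : ℝ), 0 < ω r) ∧ Tendsto ω atTop (nhds 0) ∧
    ∃ r₀ : ℝ, ∀ r ≥ r₀, ∀ u v, dom u → dom v → ∀ x : Euc d, ‖x‖ ≤ r →
      |I u x - I v x| ≤ C₀ * locN (2 * r) (fun y => u y - v y)
        + C₀ * ω r * supNorm (fun y => u y - v y)

structure LevyData (d : ℕ) where
  base : Euc d
  A : Matrix (Fin d) (Fin d) ℝ
  B : Euc d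
  C : ℝ
  μ : Measure (Euc d)

def LevyData.apply (L : LevyData d) (u : Euc d → ℝ) : ℝ :=
  (∑ i, ∑ j, L.A i j *
      iteratedFDeriv ℝ 2 u L.base ![EuclideanSpace.single i (1:ℝ), EuclideanSpace.single j (1:ℝ)])
    + fderiv ℝ u L.base L.B + L.C * u L.base
    + ∫ y, (u y - u L.base -
        Set.indicator (ball L.base 1) (fun z => fderiv ℝ u L.base (z - L.base)) y) ∂L.μ

/-- a set of functions which is (sequentially) compact in the norm of `C²_b(ℝ^d)` -/
def SeqCompactC2 (S : Set (Euc d → ℝ)) : Prop :=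
  (∀ u ∈ S, IsC2b u) ∧
    ∀ f : ℕ → Euc d → ℝ, (∀ n, f n ∈ S) →
      ∃ g ∈ S, ∃ φ : ℕ → ℕ, StrictMono φ ∧
        Tendsto (fun n => C2Norm (fun y => f (φ n) y - g y)) atTop (nhds 0)

/-- the equicontinuity assumption: for every compact family `S ⊆ C²_b`, the family of
functions `x ↦ (I(v+u)(x) - I(v)(x)) / ‖u‖_{C²}`, `u, v ∈ S`, `u ≠ 0`, is equicontinuous -/
def EquiContAssumption (I : (Euc d → ℝ) → Euc d → ℝ) : Prop :=
  ∀ S : Set (Euc d → ℝ), SeqCompactC2 S →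
    ∀ x : Euc d, ∀ ε > (0 : ℝ), ∃ δ > (0 : ℝ), ∀ u v, u ∈ S → v ∈ S → u ≠ 0 →
      ∀ y : Euc d, dist y x < δ →
        |(I (fun z => v z + u z) y - I v y) / C2Norm u -
            (I (fun z => v z + u z) x - I v x) / C2Norm u| < ε

section Helpers

open scoped Topology NNReal

lemma mv1 {φ : ℝ → ℝ} {C : ℝ≥0} (hφ : LipschitzWith C φ) {P : ℝ → Prop}
    (hP : ∀ᵐ t : ℝ, P t) {c : ℝ} (hc : c < φ 1 - φ 0) :
    ∃ t ∈ Icc (0:ℝ) 1, P t ∧ c ≤ deriv φ t := by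
  by_contra hcon
  push Not at hcon
  have hac : AbsolutelyContinuousOnInterval φ 0 1 :=
    (hφ.lipschitzOnWith (s := uIcc 0 1)).absolutelyContinuousOnInterval
  have hIntg := hac.intervalIntegrable_deriv
  have h1 := hac.integral_deriv_eq_sub
  have h2 : ∫ t in (0:ℝ)..1, deriv φ t ≤ ∫ t in (0:ℝ)..1, c := by
    apply intervalIntegral.integral_mono_ae_restrict zero_le_one hIntg (by simp)
    rw [Filter.EventuallyLE, ae_restrict_iff' measurableSet_Icc]
    filter_upwards [hP] with t ht hm
    exact (hcon t hm ht).le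
  simp at h2
  linarith

lemma rad {X : Type*} [SeminormedAddCommGroup X] [NormedSpace ℝ X] {Ω : Type*}
    (J : X → Ω → ℝ) (K : ℝ) (hK : 0 ≤ K) (hLip : ∀ u v x, |J u x - J v x| ≤ K * ‖u - v‖)
    (v h : X) (x₀ : Ω) (s : Finset X) (hs : h ∈ s) (X₀ : Finset Ω) (hx₀ : x₀ ∈ X₀)
    (ε : ℝ) (hε : 0 < ε) :
    ∃ p : X, (∃ τ ∈ Icc (0:ℝ) 1, ‖p - (v + τ • h)‖ ≤ ε) ∧
      ∃ D : X → Ω → ℝ, (∀ x ∈ X₀,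
        (∀ f ∈ Submodule.span ℝ (s : Set X),
          Tendsto (fun t : ℝ => (J (p + t • f) x - J p x) / t) (𝓝[>] 0) (𝓝 (D f x))) ∧
        (∀ f ∈ Submodule.span ℝ (s : Set X), ∀ g ∈ Submodule.span ℝ (s : Set X),
          D (f + g) x = D f x + D g x) ∧
        (∀ (c : ℝ), ∀ f ∈ Submodule.span ℝ (s : Set X), D (c • f) x = c * D f x)) ∧
      J (v + h) x₀ - J v x₀ - ε ≤ D h x₀ := by
  classical
  let Φ : (s → ℝ) →ₗ[ℝ] X := Fintype.linearCombination ℝ (fun i : s => (i : X))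
  have hΦc : Continuous Φ := Φ.continuous_of_finiteDimensional
  have hrange : ∀ f ∈ Submodule.span ℝ (s : Set X), ∃ a, Φ a = f := by
    intro f hf
    have := Fintype.range_linearCombination ℝ (fun i : s => (i : X))
    have h2 : f ∈ LinearMap.range Φ := by
      rw [this]; simpa using hf
    exact h2
  obtain ⟨M, hM0, hM⟩ := (⟨Φ, hΦc⟩ : (s → ℝ) →L[ℝ] X).bound
  have hM' : ∀ a, ‖Φ a‖ ≤ M * ‖a‖ := hM
  let G : Ω → (s → ℝ) → ℝ := fun x a => J (v + Φ a) x
  have hG : ∀ x, LipschitzWith (Real.toNNReal (K * M)) (G x) := by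
    intro x
    apply LipschitzWith.of_dist_le_mul
    intro a b
    rw [Real.coe_toNNReal _ (by positivity), Real.dist_eq, dist_eq_norm]
    refine (hLip _ _ _).trans ?_
    have : v + Φ a - (v + Φ b) = Φ (a - b) := by rw [map_sub]; abel
    rw [this, mul_assoc]
    exact mul_le_mul_of_nonneg_left (hM' _) hK
  let T : Set (s → ℝ) := ⋂ x ∈ X₀, {a | DifferentiableAt ℝ (G x) a}
  have hTm : MeasurableSet T :=
    Finset.measurableSet_biInter _ fun x _ => measurableSet_of_differentiableAt ℝ (G x)
  have hT : ∀ᵐ a : s → ℝ, a ∈ T := by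
    simp only [T, mem_iInter]
    exact (ae_ball_iff X₀.countable_toSet).2 fun x _ => (hG x).ae_differentiableAt
  let e : s → ℝ := Pi.single ⟨h, hs⟩ 1
  have he : Φ e = h := by
    simp [Φ, e, Fintype.linearCombination_apply_single]
  have hT2 := (ae_ae_add_linearMap_mem_iff (LinearMap.toSpanSingleton ℝ (s → ℝ) e)
    (volume : Measure ℝ) (volume : Measure (s → ℝ)) hTm).2 hT
  -- choose small a
  have hη : ∀ᶠ a in 𝓝 (0 : s → ℝ), ‖Φ a‖ < min ε (ε / (4 * (K + 1))) := by
    have : Tendsto (fun a => ‖Φ a‖) (𝓝 0) (𝓝 0) := by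
      have := (hΦc.norm).tendsto 0
      simpa using this
    exact this.eventually (gt_mem_nhds (by positivity))
  obtain ⟨a, ha1, ha2⟩ : ∃ a : s → ℝ, ‖Φ a‖ < min ε (ε / (4 * (K + 1))) ∧
      ∀ᵐ t : ℝ, a + LinearMap.toSpanSingleton ℝ (s → ℝ) e t ∈ T := by
    have hd := Measure.dense_of_ae hT2
    obtain ⟨a, ha, ha'⟩ := hd.exists_mem_open isOpen_interior (⟨0, mem_interior_iff_mem_nhds.2 hη⟩)
    exact ⟨a, (interior_subset ha' : a ∈ {x | ‖Φ x‖ < min ε (ε / (4 * (K + 1)))}), ha⟩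
  have hKa : K * ‖Φ a‖ ≤ ε / 4 := by
    have : ‖Φ a‖ ≤ ε / (4 * (K + 1)) := (ha1.trans_le (min_le_right _ _)).le
    rw [le_div_iff₀ (by positivity)] at this
    nlinarith [norm_nonneg (Φ a)]
  let φ : ℝ → ℝ := fun t => G x₀ (a + t • e)
  have hφ : LipschitzWith (Real.toNNReal (K * M) * ‖e‖₊) φ := by
    refine (hG x₀).comp ?_
    apply LipschitzWith.of_dist_le_mul
    intro t r
    simp [dist_eq_norm, ← sub_smul, norm_smul, mul_comm]
  have h0 : |φ 0 - J v x₀| ≤ ε / 4 := by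
    refine (hLip _ _ _).trans ?_
    simpa using hKa
  have h1 : |φ 1 - J (v + h) x₀| ≤ ε / 4 := by
    refine (hLip _ _ _).trans ?_
    have : v + Φ (a + (1:ℝ) • e) - (v + h) = Φ a := by
      rw [one_smul, map_add, he]; abel
    rw [this]; exact hKa
  have hc : J (v + h) x₀ - J v x₀ - ε < φ 1 - φ 0 := by
    rw [abs_le] at h0 h1
    linarith
  obtain ⟨τ, hτ, hτT, hτd⟩ := mv1 hφ ha2 hc
  have hτT' : ∀ x ∈ X₀, DifferentiableAt ℝ (G x) (a + τ • e) := by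
    intro x hx
    have : a + τ • e ∈ T := by simpa using hτT
    simp only [T, mem_iInter] at this
    exact this x hx
  refine ⟨v + Φ (a + τ • e), ⟨τ, hτ, ?_⟩, fun f x =>
    if hf : f ∈ Submodule.span ℝ (s : Set X) then fderiv ℝ (G x) (a + τ • e) (hrange f hf).choose
      else 0, ?_, ?_⟩
  · have : v + Φ (a + τ • e) - (v + τ • h) = Φ a := by
      rw [map_add, map_smul, he]; abel
    rw [this]
    exact (ha1.trans_le (min_le_left _ _)).le
  · intro x hx
    have hlim : ∀ b, Tendsto (fun t : ℝ => (J (v + Φ (a + τ • e) + t • Φ b) x -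
        J (v + Φ (a + τ • e)) x) / t) (𝓝[>] 0) (𝓝 (fderiv ℝ (G x) (a + τ • e) b)) := by
      intro b
      have h1 := (hτT' x hx).hasFDerivAt.hasLineDerivAt b
      have h2 := (hasDerivAt_iff_tendsto_slope.1 h1)
      have h3 := h2.mono_left (nhdsWithin_mono 0 (fun t (ht : 0 < t) => ht.ne') :
        𝓝[>] (0:ℝ) ≤ _)
      refine h3.congr fun t => ?_
      simp only [slope_def_field, G, map_add, map_smul, sub_zero, zero_smul, add_zero, add_assoc]
    have hval : ∀ b b', Φ b = Φ b' → fderiv ℝ (G x) (a + τ • e) b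
        = fderiv ℝ (G x) (a + τ • e) b' := by
      intro b b' hb
      have := hlim b
      rw [hb] at this
      exact tendsto_nhds_unique this (hlim b')
    refine ⟨?_, ?_, ?_⟩
    · intro f hf
      simp only [dif_pos hf]
      have := hlim (hrange f hf).choose
      rwa [(hrange f hf).choose_spec] at this
    · intro f hf g hg
      have hfg := Submodule.add_mem _ hf hg
      simp only [dif_pos hf, dif_pos hg, dif_pos hfg]
      rw [← map_add]
      apply hval
      rw [map_add, (hrange f hf).choose_spec, (hrange g hg).choose_spec,
        (hrange _ hfg).choose_spec]
    · intro c f hf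
      have hfg := Submodule.smul_mem _ c hf
      simp only [dif_pos hf, dif_pos hfg]
      rw [← smul_eq_mul, ← map_smul]
      apply hval
      rw [map_smul, (hrange f hf).choose_spec, (hrange _ hfg).choose_spec]
  · have hh : h ∈ Submodule.span ℝ (s : Set X) := Submodule.subset_span hs
    simp only [dif_pos hh]
    have hd1 : HasDerivAt φ (fderiv ℝ (G x₀) (a + τ • e) e) τ := by
      have h1 := (hτT' x₀ hx₀).hasFDerivAt
      have h2 : HasDerivAt (fun t : ℝ => a + t • e) e τ := by
        simpa using ((hasDerivAt_id τ).smul_const e).const_add a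
      exact h1.comp_hasDerivAt τ h2
    have hlim : ∀ b, Tendsto (fun t : ℝ => (J (v + Φ (a + τ • e) + t • Φ b) x₀ -
        J (v + Φ (a + τ • e)) x₀) / t) (𝓝[>] 0) (𝓝 (fderiv ℝ (G x₀) (a + τ • e) b)) := by
      intro b
      have h1 := (hτT' x₀ hx₀).hasFDerivAt.hasLineDerivAt b
      have h2 := (hasDerivAt_iff_tendsto_slope.1 h1)
      have h3 := h2.mono_left (nhdsWithin_mono 0 (fun t (ht : 0 < t) => ht.ne') :
        𝓝[>] (0:ℝ) ≤ _)
      refine h3.congr fun t => ?_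
      simp only [slope_def_field, G, map_add, map_smul, sub_zero, zero_smul, add_zero, add_assoc]
    have h4 := hlim e
    have h5 := hlim (hrange h hh).choose
    rw [(hrange h hh).choose_spec] at h5
    rw [he] at h4
    rw [tendsto_nhds_unique h5 h4, ← hd1.deriv]
    exact hτd

lemma equi_nbhd {X : Type*} [SeminormedAddCommGroup X] [NormedSpace ℝ X] {Ω : Type*}
    [PseudoMetricSpace Ω] (J : X → Ω → ℝ)
    (hequi : ∀ S : Set X, IsCompact S → ∀ x, ∀ ε > (0:ℝ), ∃ δ > (0:ℝ), ∀ u ∈ S, ∀ v ∈ S,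
      ∀ y, dist y x < δ → |(J (v + u) y - J v y) - (J (v + u) x - J v x)| ≤ ε * ‖u‖)
    (v h f : X) (x : Ω) (ε : ℝ) (hε : 0 < ε) :
    ∃ δ > (0:ℝ), ∃ η > (0:ℝ), ∀ p : X, ∀ τ ∈ Icc (0:ℝ) 1, ‖p - (v + τ • h)‖ ≤ η →
      ∀ t ∈ Icc (0:ℝ) 1, ∀ y, dist y x < δ →
        |(J (p + t • f) y - J p y) - (J (p + t • f) x - J p x)| ≤ ε * ‖t • f‖ := by
  by_contra hcon
  push Not at hcon
  have hpos : ∀ n : ℕ, (0:ℝ) < 1 / ((n:ℝ) + 1) := fun n => by positivity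
  choose p τ hτ hp t ht y hy hbad using fun n : ℕ => hcon _ (hpos n) _ (hpos n)
  obtain ⟨τ', hτ', φ, hφ, hlim⟩ := isCompact_Icc.tendsto_subseq hτ
  have hzero : Tendsto (fun n : ℕ => 1 / (((φ n : ℕ):ℝ) + 1)) atTop (𝓝 0) :=
    (tendsto_one_div_add_atTop_nhds_zero_nat (𝕜 := ℝ)).comp hφ.tendsto_atTop
  have hplim : Tendsto (p ∘ φ) atTop (𝓝 (v + τ' • h)) := by
    have h1 : Tendsto (fun n => p (φ n) - (v + τ (φ n) • h)) atTop (𝓝 0) :=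
      squeeze_zero_norm (fun n => hp (φ n)) hzero
    have h2 : Tendsto (fun n => v + τ (φ n) • h) atTop (𝓝 (v + τ' • h)) :=
      (hlim.smul_const h).const_add v
    have h3 := h1.add h2
    simpa [Function.comp_def] using h3
  have hS : IsCompact (insert (v + τ' • h) (range (p ∘ φ)) ∪ (fun t : ℝ => t • f) '' Icc 0 1) :=
    hplim.isCompact_insert_range.union
      (isCompact_Icc.image (continuous_id.smul continuous_const))
  obtain ⟨δ, hδ, H⟩ := hequi _ hS x ε hε
  obtain ⟨n, hn⟩ := (hzero.eventually (gt_mem_nhds hδ)).exists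
  have := H (t (φ n) • f) (Or.inr ⟨_, ht _, rfl⟩) (p (φ n)) (Or.inl (Or.inr ⟨n, rfl⟩)) (y (φ n))
    ((hy _).trans hn)
  exact absurd this (not_le.2 (hbad (φ n)))

theorem exists_linear {X : Type*} [SeminormedAddCommGroup X] [NormedSpace ℝ X] {Ω : Type*}
    [PseudoMetricSpace Ω] (J : X → Ω → ℝ)
    (K : ℝ) (hK : 0 ≤ K) (hLip : ∀ u v x, |J u x - J v x| ≤ K * ‖u - v‖)
    (hequi : ∀ S : Set X, IsCompact S → ∀ x, ∀ ε > (0:ℝ), ∃ δ > (0:ℝ), ∀ u ∈ S, ∀ v ∈ S,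
      ∀ y, dist y x < δ → |(J (v + u) y - J v y) - (J (v + u) x - J v x)| ≤ ε * ‖u‖)
    (v h : X) (x₀ : Ω) :
    ∃ L : X →ₗ[ℝ] (Ω → ℝ), (∀ f, Continuous (L f)) ∧
      (∀ f x c, (∀ p (t : ℝ), 0 < t → J (p + t • f) x - J p x ≤ t * c) → L f x ≤ c) ∧
      J (v + h) x₀ ≤ J v x₀ + L h x₀ := by
  classical
  let ι := Finset X × Finset Ω × ℕ
  have key : ∀ i : ι, _ := fun i => rad J K hK hLip v h x₀ (insert h i.1)
    (Finset.mem_insert_self _ _) (insert x₀ i.2.1) (Finset.mem_insert_self _ _)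
    (1 / ((i.2.2 : ℝ) + 1)) (by positivity)
  choose p hp D hD hDh using key
  let U : Ultrafilter ι := Ultrafilter.of atTop
  have hU : (U : Filter ι) ≤ atTop := Ultrafilter.of_le _
  have ev1 : ∀ f : X, ∀ᶠ i in (U : Filter ι),
      f ∈ Submodule.span ℝ ((insert h i.1 : Finset X) : Set X) := by
    intro f
    apply hU
    filter_upwards [eventually_ge_atTop (({f}, ∅, 0) : ι)] with i hi
    apply Submodule.subset_span
    have : f ∈ i.1 := hi.1 (Finset.mem_singleton_self f)
    simp [this]
  have ev2 : ∀ x : Ω, ∀ᶠ i in (U : Filter ι), x ∈ insert x₀ i.2.1 := by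
    intro x
    apply hU
    filter_upwards [eventually_ge_atTop ((∅, {x}, 0) : ι)] with i hi
    have : x ∈ i.2.1 := hi.2.1 (Finset.mem_singleton_self x)
    simp [this]
  have ev3 : Tendsto (fun i : ι => 1 / ((i.2.2 : ℝ) + 1)) U (𝓝 0) := by
    have : Tendsto (fun i : ι => i.2.2) U atTop := by
      rw [Filter.tendsto_atTop]
      intro n
      apply hU
      filter_upwards [eventually_ge_atTop ((∅, ∅, n) : ι)] with i hi
      exact hi.2.2
    exact (tendsto_one_div_add_atTop_nhds_zero_nat (𝕜 := ℝ)).comp this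
  have hle : ∀ f x c, (∀ p (t : ℝ), 0 < t → J (p + t • f) x - J p x ≤ t * c) →
      ∀ᶠ i in (U : Filter ι), D i f x ≤ c := by
    intro f x c hc
    filter_upwards [ev1 f, ev2 x] with i h1 h2
    refine le_of_tendsto ((hD i x h2).1 f h1) ?_
    filter_upwards [self_mem_nhdsWithin] with t ht
    rw [div_le_iff₀ ht, mul_comm c t]
    exact hc _ _ ht
  have hge : ∀ f x c, (∀ p (t : ℝ), 0 < t → t * c ≤ J (p + t • f) x - J p x) →
      ∀ᶠ i in (U : Filter ι), c ≤ D i f x := by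
    intro f x c hc
    filter_upwards [ev1 f, ev2 x] with i h1 h2
    refine ge_of_tendsto ((hD i x h2).1 f h1) ?_
    filter_upwards [self_mem_nhdsWithin] with t ht
    rw [le_div_iff₀ ht, mul_comm c t]
    exact hc _ _ ht
  have hquot : ∀ f x p (t : ℝ), 0 < t → |J (p + t • f) x - J p x| ≤ t * (K * ‖f‖) := by
    intro f x p t ht
    refine (hLip _ _ _).trans (le_of_eq ?_)
    rw [add_sub_cancel_left, norm_smul, Real.norm_of_nonneg ht.le]; ring
  have hex : ∀ f x, ∃ l : ℝ, Tendsto (fun i => D i f x) U (𝓝 l) := by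
    intro f x
    have h1 := hle f x (K * ‖f‖) fun p t ht => (abs_le.1 (hquot f x p t ht)).2
    have h2 := hge f x (-(K * ‖f‖)) fun p t ht => by
      have := (abs_le.1 (hquot f x p t ht)).1; linarith
    have hc : (U.map fun i => D i f x : Filter ℝ) ≤ 𝓟 (Icc (-(K * ‖f‖)) (K * ‖f‖)) := by
      rw [Filter.le_principal_iff]
      exact (h2.and h1 : ∀ᶠ i in (U : Filter ι), D i f x ∈ Icc (-(K * ‖f‖)) (K * ‖f‖))
    obtain ⟨l, -, hl⟩ := isCompact_Icc.ultrafilter_le_nhds (U.map fun i => D i f x) hc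
    exact ⟨l, hl⟩
  choose L hL using hex
  refine ⟨{ toFun := L, map_add' := ?_, map_smul' := ?_ }, ?_, ?_, ?_⟩
  · intro f g
    ext x
    refine tendsto_nhds_unique (hL (f + g) x) (((hL f x).add (hL g x)).congr' ?_)
    filter_upwards [ev1 f, ev1 g, ev2 x] with i h1 h2 h3
    exact ((hD i x h3).2.1 f h1 g h2).symm
  · intro c f
    ext x
    refine tendsto_nhds_unique (hL (c • f) x) (((hL f x).const_mul c).congr' ?_)
    filter_upwards [ev1 f, ev2 x] with i h1 h3
    exact ((hD i x h3).2.2 c f h1).symm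
  · intro f
    rw [Metric.continuous_iff']
    intro x ε hε
    obtain ⟨δ, hδ, η, hη, H⟩ := equi_nbhd J hequi v h f x (ε / (2 * (‖f‖ + 1))) (by positivity)
    filter_upwards [Metric.ball_mem_nhds x hδ] with y hy
    have hlim : Tendsto (fun i => |D i f y - D i f x|) U (𝓝 |L f y - L f x|) :=
      ((hL f y).sub (hL f x)).abs
    rw [Real.dist_eq]
    refine lt_of_le_of_lt (b := ε / 2) ?_ (by linarith)
    refine le_of_tendsto hlim ?_
    filter_upwards [ev1 f, ev2 x, ev2 y, ev3.eventually (gt_mem_nhds hη)] with i h1 h2 h3 h4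
    obtain ⟨τ, hτ, hτp⟩ := hp i
    refine le_of_tendsto ((((hD i y h3).1 f h1).sub ((hD i x h2).1 f h1)).abs) ?_
    filter_upwards [Ioc_mem_nhdsGT (zero_lt_one (α := ℝ))] with t ht
    have := H (p i) τ hτ (hτp.trans h4.le) t ⟨ht.1.le, ht.2⟩ y hy
    rw [← sub_div, abs_div, abs_of_pos ht.1, div_le_iff₀ ht.1]
    refine this.trans ?_
    rw [norm_smul, Real.norm_of_nonneg ht.1.le, div_mul_eq_mul_div, div_le_iff₀ (by positivity)]
    nlinarith [norm_nonneg f, mul_pos hε ht.1]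
  · intro f x c hc
    exact le_of_tendsto (hL f x) (hle f x c hc)
  · have h1 : Tendsto (fun i : ι => J (v + h) x₀ - J v x₀ - 1 / ((i.2.2 : ℝ) + 1)) U
        (𝓝 (J (v + h) x₀ - J v x₀ - 0)) := tendsto_const_nhds.sub ev3
    have h2 := le_of_tendsto_of_tendsto' h1 (hL h x₀) hDh
    change J (v + h) x₀ ≤ J v x₀ + L h x₀
    linarith

lemma IsC2b.add {u v : Euc d → ℝ} (hu : IsC2b u) (hv : IsC2b v) :
    IsC2b (fun y => u y + v y) := by
  obtain ⟨hu1, M, hM⟩ := hu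
  obtain ⟨hv1, N, hN⟩ := hv
  refine ⟨hu1.add hv1, M + N, fun x => ⟨?_, ?_, ?_⟩⟩
  · exact (abs_add_le _ _).trans (add_le_add (hM x).1 (hN x).1)
  · rw [fderiv_fun_add ((hu1.differentiable (by norm_num)) x) ((hv1.differentiable (by norm_num)) x)]
    exact (norm_add_le _ _).trans (add_le_add (hM x).2.1 (hN x).2.1)
  · rw [fun_iteratedFDeriv_add_apply hu1.contDiffAt hv1.contDiffAt]
    exact (norm_add_le _ _).trans (add_le_add (hM x).2.2 (hN x).2.2)

lemma fderiv_cmul {u : Euc d → ℝ} (hu : ContDiff ℝ 2 u) (c : ℝ) (x : Euc d) :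
    fderiv ℝ (fun y => c * u y) x = c • fderiv ℝ u x :=
  fderiv_const_mul ((hu.differentiable (by norm_num)) x) c

lemma hess_cmul {u : Euc d → ℝ} (hu : ContDiff ℝ 2 u) (c : ℝ) (x : Euc d) :
    iteratedFDeriv ℝ 2 (fun y => c * u y) x = c • iteratedFDeriv ℝ 2 u x :=
  iteratedFDeriv_const_smul_apply (a := c) hu.contDiffAt

lemma IsC2b.cmul {u : Euc d → ℝ} (hu : IsC2b u) (c : ℝ) : IsC2b (fun y => c * u y) := by
  obtain ⟨hu1, M, hM⟩ := hu
  refine ⟨contDiff_const.mul hu1, |c| * M, fun x => ⟨?_, ?_, ?_⟩⟩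
  · rw [abs_mul]; exact mul_le_mul_of_nonneg_left (hM x).1 (abs_nonneg c)
  · rw [fderiv_cmul hu1, norm_smul]
    exact mul_le_mul_of_nonneg_left (hM x).2.1 (abs_nonneg c)
  · rw [hess_cmul hu1, norm_smul]
    exact mul_le_mul_of_nonneg_left (hM x).2.2 (abs_nonneg c)

lemma isC2b_const (c : ℝ) : IsC2b (fun _ : Euc d => c) := by
  refine ⟨contDiff_const, |c|, fun x => ⟨le_rfl, by simp, ?_⟩⟩
  rw [iteratedFDeriv_const_of_ne (by norm_num)]
  simp

lemma isC2b_of_compact {u : Euc d → ℝ} (hu : ContDiff ℝ 2 u) (hc : HasCompactSupport u) :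
    IsC2b u := by
  obtain ⟨M1, h1⟩ := hu.continuous.bounded_above_of_compact_support hc
  obtain ⟨M2, h2⟩ := (hu.continuous_fderiv (by norm_num)).bounded_above_of_compact_support
    (hc.fderiv (𝕜 := ℝ))
  obtain ⟨M3, h3⟩ := (hu.continuous_iteratedFDeriv (m := 2) (by norm_num)).bounded_above_of_compact_support
    (hc.iteratedFDeriv (𝕜 := ℝ) 2)
  refine ⟨hu, max M1 (max M2 M3), fun x => ⟨?_, ?_, ?_⟩⟩
  · exact (h1 x).trans (le_max_left _ _)
  · exact (h2 x).trans ((le_max_left _ _).trans (le_max_right _ _))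
  · exact (h3 x).trans ((le_max_right _ _).trans (le_max_right _ _))

lemma IsC2b.sub {u v : Euc d → ℝ} (hu : IsC2b u) (hv : IsC2b v) :
    IsC2b (fun y => u y - v y) := by
  have := hu.add (hv.cmul (-1))
  simpa [sub_eq_add_neg] using this

/-- the vector space of `C²_b` functions -/
def C2bSub (d : ℕ) : Submodule ℝ (Euc d → ℝ) where
  carrier := {u | IsC2b u}
  add_mem' hu hv := IsC2b.add hu hv
  zero_mem' := isC2b_const 0
  smul_mem' c _ hu := IsC2b.cmul hu c

/-- type copy of `C2bSub`, to be normed by `C2Norm` -/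
def C2b (d : ℕ) : Type := C2bSub d

instance : AddCommGroup (C2b d) := inferInstanceAs (AddCommGroup (C2bSub d))
instance : Module ℝ (C2b d) := inferInstanceAs (Module ℝ (C2bSub d))

/-- underlying function -/
def C2b.fn (u : C2b d) : Euc d → ℝ := u.1

/-- constructor -/
def C2b.mk (u : Euc d → ℝ) (hu : IsC2b u) : C2b d := ⟨u, hu⟩

lemma C2b.isC2b (u : C2b d) : IsC2b u.fn := u.2
@[simp] lemma C2b.fn_mk (u : Euc d → ℝ) (hu : IsC2b u) : (C2b.mk u hu).fn = u := rfl
@[simp] lemma C2b.fn_add (u v : C2b d) (y : Euc d) : (u + v).fn y = u.fn y + v.fn y := rfl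
@[simp] lemma C2b.fn_sub (u v : C2b d) (y : Euc d) : (u - v).fn y = u.fn y - v.fn y := rfl
@[simp] lemma C2b.fn_smul (c : ℝ) (u : C2b d) (y : Euc d) : (c • u).fn y = c * u.fn y := rfl
@[simp] lemma C2b.fn_zero (y : Euc d) : (0 : C2b d).fn y = 0 := rfl
lemma C2b.ext {u v : C2b d} (h : ∀ y, u.fn y = v.fn y) : u = v := Subtype.ext (funext h)
/-- evaluation as a linear map -/
def C2b.evalL (y : Euc d) : C2b d →ₗ[ℝ] ℝ where
  toFun u := u.fn y
  map_add' _ _ := rfl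
  map_smul' _ _ := rfl
lemma C2b.fn_sum {ι : Type*} (s : Finset ι) (u : ι → C2b d) (y : Euc d) :
    (∑ i ∈ s, u i).fn y = ∑ i ∈ s, (u i).fn y :=
  map_sum (C2b.evalL y) u s

lemma IsC2b.bdd {u : Euc d → ℝ} (hu : IsC2b u) :
    BddAbove (range fun x => |u x|) ∧ BddAbove (range fun x => ‖fderiv ℝ u x‖) ∧
      BddAbove (range fun x => ‖iteratedFDeriv ℝ 2 u x‖) := by
  obtain ⟨hu1, M, hM⟩ := hu
  refine ⟨⟨M, ?_⟩, ⟨M, ?_⟩, ⟨M, ?_⟩⟩ <;> rintro _ ⟨x, rfl⟩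
  exacts [(hM x).1, (hM x).2.1, (hM x).2.2]

lemma C2Norm_nonneg (u : Euc d → ℝ) : 0 ≤ C2Norm u :=
  add_nonneg (add_nonneg (Real.iSup_nonneg fun _ => abs_nonneg _)
    (Real.iSup_nonneg fun _ => norm_nonneg _)) (Real.iSup_nonneg fun _ => norm_nonneg _)

lemma C2Norm_add {u v : Euc d → ℝ} (hu : IsC2b u) (hv : IsC2b v) :
    C2Norm (fun y => u y + v y) ≤ C2Norm u + C2Norm v := by
  obtain ⟨a1, a2, a3⟩ := hu.bdd
  obtain ⟨b1, b2, b3⟩ := hv.bdd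
  have h1 : supNorm (fun y => u y + v y) ≤ supNorm u + supNorm v :=
    ciSup_le fun x => (abs_add_le _ _).trans (add_le_add (le_ciSup a1 x) (le_ciSup b1 x))
  have h2 : gradSup (fun y => u y + v y) ≤ gradSup u + gradSup v := by
    refine ciSup_le fun x => ?_
    rw [fderiv_fun_add ((hu.1.differentiable (by norm_num)) x) ((hv.1.differentiable (by norm_num)) x)]
    exact (norm_add_le _ _).trans (add_le_add (le_ciSup a2 x) (le_ciSup b2 x))
  have h3 : hessSup (fun y => u y + v y) ≤ hessSup u + hessSup v := by
    refine ciSup_le fun x => ?_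
    rw [fun_iteratedFDeriv_add_apply hu.1.contDiffAt hv.1.contDiffAt]
    exact (norm_add_le _ _).trans (add_le_add (le_ciSup a3 x) (le_ciSup b3 x))
  unfold C2Norm
  linarith

lemma C2Norm_cmul {u : Euc d → ℝ} (hu : IsC2b u) (c : ℝ) :
    C2Norm (fun y => c * u y) = |c| * C2Norm u := by
  have h1 : supNorm (fun y => c * u y) = |c| * supNorm u := by
    simp only [supNorm, abs_mul]
    rw [Real.mul_iSup_of_nonneg (abs_nonneg c)]
  have h2 : gradSup (fun y => c * u y) = |c| * gradSup u := by
    simp only [gradSup, fderiv_cmul hu.1, norm_smul, Real.norm_eq_abs]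
    rw [Real.mul_iSup_of_nonneg (abs_nonneg c)]
  have h3 : hessSup (fun y => c * u y) = |c| * hessSup u := by
    simp only [hessSup, hess_cmul hu.1, norm_smul, Real.norm_eq_abs]
    rw [Real.mul_iSup_of_nonneg (abs_nonneg c)]
  unfold C2Norm
  rw [h1, h2, h3]; ring

/-- the norm -/
def C2b.seminorm (d : ℕ) : Seminorm ℝ (C2b d) :=
  Seminorm.of (fun u => C2Norm u.fn) (fun u v => C2Norm_add u.isC2b v.isC2b)
    (fun c u => C2Norm_cmul u.isC2b c)

instance : SeminormedAddCommGroup (C2b d) :=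
  AddGroupSeminorm.toSeminormedAddCommGroup (C2b.seminorm d).toAddGroupSeminorm

lemma C2b.norm_def (u : C2b d) : ‖u‖ = C2Norm u.fn := rfl

instance : NormedSpace ℝ (C2b d) where
  norm_smul_le c u := (C2Norm_cmul u.isC2b c).le

lemma seqCompact_image {S : Set (C2b d)} (hS : IsCompact S) : SeqCompactC2 (C2b.fn '' S) := by
  refine ⟨?_, ?_⟩
  · rintro _ ⟨u, -, rfl⟩; exact u.isC2b
  · intro f hf
    choose F hF hFf using hf
    obtain ⟨g, hg, φ, hφ, hlim⟩ := hS.isSeqCompact hF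
    refine ⟨g.fn, ⟨g, hg, rfl⟩, φ, hφ, ?_⟩
    have := tendsto_iff_norm_sub_tendsto_zero.1 hlim
    refine this.congr fun n => ?_
    rw [C2b.norm_def]
    simp only [← hFf]
    rfl

lemma taylor2 {w : Euc d → ℝ} (hw : ContDiff ℝ 2 w) (x : Euc d) :
    Tendsto (fun y => (w y - w x - fderiv ℝ w x (y - x)
      - (1/2) * fderiv ℝ (fderiv ℝ w) x (y - x) (y - x)) / ‖y - x‖ ^ 2) (𝓝 x) (𝓝 0) := by
  have hd1 : Differentiable ℝ w := hw.differentiable (by norm_num)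
  have hd2 : Differentiable ℝ (fderiv ℝ w) :=
    (hw.fderiv_right (m := 1) (by norm_num)).differentiable (by norm_num)
  set B := fderiv ℝ (fderiv ℝ w) x with hB
  have hsymm : ∀ a b, B a b = B b a := second_derivative_symmetric
    (fun y => (hd1 y).hasFDerivAt) (hd2 x).hasFDerivAt
  let F : Euc d → ℝ := fun y => w y - w x - fderiv ℝ w x (y - x) - (1/2) * B (y - x) (y - x)
  have hF : ∀ y, HasFDerivAt F (fderiv ℝ w y - fderiv ℝ w x - B (y - x)) y := by
    intro y
    have hs : HasFDerivAt (fun y : Euc d => y - x) (ContinuousLinearMap.id ℝ (Euc d)) y :=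
      (hasFDerivAt_id y).sub_const x
    have h1 := (hd1 y).hasFDerivAt.sub_const (w x)
    have h2 := (fderiv ℝ w x).hasFDerivAt.comp y hs
    have h3 := ((B.hasFDerivAt.comp y hs).clm_apply hs).const_mul (1/2 : ℝ)
    refine ((h1.sub h2).sub h3).congr_fderiv ?_
    ext a
    simp [hsymm a]
    ring
  have ho := (hd2 x).hasFDerivAt.isLittleO
  rw [Metric.tendsto_nhds]
  intro ε hε
  have h1 := ho.def (half_pos hε)
  obtain ⟨r, hr, hball⟩ := Metric.eventually_nhds_iff_ball.1 h1
  filter_upwards [Metric.ball_mem_nhds x hr] with y hy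
  rw [dist_zero_right, norm_div, norm_pow, norm_norm]
  by_cases hyx : y = x
  · subst hyx; simpa using hε
  have hpos : 0 < ‖y - x‖ := norm_pos_iff.2 (sub_ne_zero.2 hyx)
  rw [div_lt_iff₀ (by positivity)]
  have hmv : ‖F y - F x‖ ≤ (ε / 2 * ‖y - x‖) * ‖y - x‖ := by
    have hconv : Convex ℝ (closedBall x ‖y - x‖) := convex_closedBall _ _
    refine hconv.norm_image_sub_le_of_norm_hasFDerivWithin_le
      (fun z _ => (hF z).hasFDerivWithinAt) (fun z hz => ?_)
      (mem_closedBall_self (norm_nonneg _)) (by simp [dist_eq_norm])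
    have hz' : ‖z - x‖ ≤ ‖y - x‖ := by simpa [dist_eq_norm] using hz
    have hz2 : z ∈ ball x r := by
      rw [mem_ball, dist_eq_norm] at hy ⊢
      linarith
    exact (hball z hz2).trans (mul_le_mul_of_nonneg_left hz' (by positivity))
  have hFx : F x = 0 := by simp [F]
  rw [hFx, sub_zero] at hmv
  refine lt_of_le_of_lt hmv ?_
  nlinarith [mul_pos hε (mul_pos hpos hpos)]

/-- a weight comparable to `min 1 |y - x|²` -/
def bmp (x : Euc d) : ContDiffBump x := ⟨1, 2, one_pos, one_lt_two⟩

def wt (x y : Euc d) : ℝ := 1 + bmp x y * (‖y - x‖ ^ 2 - 1)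

lemma contDiff_bmp (x : Euc d) : ContDiff ℝ 2 (bmp x) := (bmp x).contDiff

lemma contDiff_nsq (x : Euc d) : ContDiff ℝ 2 (fun y : Euc d => ‖y - x‖ ^ 2) :=
  (contDiff_id.sub contDiff_const).norm_sq ℝ

lemma contDiff_coord (x : Euc d) (i : Fin d) : ContDiff ℝ 2 (fun y : Euc d => (y - x) i) :=
  ((EuclideanSpace.proj (𝕜 := ℝ) i).contDiff).comp (contDiff_id.sub contDiff_const)

lemma isC2b_bmp_mul (x : Euc d) {g : Euc d → ℝ} (hg : ContDiff ℝ 2 g) :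
    IsC2b (fun y => bmp x y * g y) :=
  isC2b_of_compact ((contDiff_bmp x).mul hg) ((bmp x).hasCompactSupport.mul_right)

lemma isC2b_wt (x : Euc d) : IsC2b (wt x) :=
  (isC2b_const 1).add (isC2b_bmp_mul x ((contDiff_nsq x).sub contDiff_const))

lemma bmp_one {x y : Euc d} (h : ‖y - x‖ ≤ 1) : bmp x y = 1 :=
  (bmp x).one_of_mem_closedBall (by simpa [mem_closedBall, dist_eq_norm, bmp] using h)

lemma wt_eq {x y : Euc d} (h : ‖y - x‖ ≤ 1) : wt x y = ‖y - x‖ ^ 2 := by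
  simp [wt, bmp_one h]

lemma wt_ge (x y : Euc d) : min 1 (‖y - x‖ ^ 2) ≤ wt x y := by
  rcases le_total ‖y - x‖ 1 with h | h
  · rw [wt_eq h]; exact min_le_right _ _
  · refine (min_le_left _ _).trans ?_
    have : 1 ≤ ‖y - x‖ ^ 2 := by nlinarith
    have h0 : 0 ≤ bmp x y := (bmp x).nonneg
    unfold wt
    nlinarith

lemma mn_nonneg (x y : Euc d) : 0 ≤ min 1 (‖y - x‖ ^ 2) := by positivity

lemma mn_pos {x y : Euc d} (h : y ≠ x) : 0 < min 1 (‖y - x‖ ^ 2) := by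
  have : 0 < ‖y - x‖ := norm_pos_iff.2 (sub_ne_zero.2 h)
  positivity

lemma wt_nonneg (x y : Euc d) : 0 ≤ wt x y := (mn_nonneg x y).trans (wt_ge x y)

lemma wt_pos {x y : Euc d} (h : y ≠ x) : 0 < wt x y := (mn_pos h).trans_le (wt_ge x y)

lemma wt_self (x : Euc d) : wt x x = 0 := by rw [wt_eq (by simp)]; simp

/-- Extension and Riesz representation. -/
lemma exists_nu (x : Euc d) (ℓ : C2b d →ₗ[ℝ] ℝ)
    (hpos : ∀ f : C2b d, (∀ y, 0 ≤ f.fn y) → f.fn x = 0 → 0 ≤ ℓ f) :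
    ∃ ν : Measure (Euc d), IsFiniteMeasure ν ∧ ∀ (g : Euc d → ℝ), Continuous g →
      HasCompactSupport g → ∀ f : C2b d, (∀ y, f.fn y = g y * wt x y) → ℓ f = ∫ y, g y ∂ν := by
  classical
  let W : Submodule ℝ (BoundedContinuousFunction (Euc d) ℝ) :=
    { carrier := {g | IsC2b (fun y => g y * wt x y)}
      add_mem' := by
        intro a b ha hb
        have := IsC2b.add ha hb
        simpa [add_mul] using this
      zero_mem' := by simpa using isC2b_const (d := d) 0
      smul_mem' := by
        intro c a ha
        have := IsC2b.cmul ha c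
        simpa [mul_assoc] using this }
  let T : W →ₗ[ℝ] C2b d :=
    { toFun := fun g => C2b.mk (fun y => g.1 y * wt x y) g.2
      map_add' := by intro a b; apply C2b.ext; intro y; simp [add_mul]
      map_smul' := by intro c a; apply C2b.ext; intro y; simp [mul_assoc] }
  let f : BoundedContinuousFunction (Euc d) ℝ →ₗ.[ℝ] ℝ := ⟨W, ℓ ∘ₗ T⟩
  let cone : PointedCone ℝ (BoundedContinuousFunction (Euc d) ℝ) :=
    { carrier := {g | ∀ y, 0 ≤ g y}
      add_mem' := fun ha hb y => add_nonneg (ha y) (hb y)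
      zero_mem' := fun y => le_rfl
      smul_mem' := fun c a ha y => mul_nonneg c.2 (ha y) }
  have h1W : (1 : BoundedContinuousFunction (Euc d) ℝ) ∈ W := by
    change IsC2b (fun y => (1 : BoundedContinuousFunction (Euc d) ℝ) y * wt x y)
    simpa using isC2b_wt x
  obtain ⟨Λ, hΛ1, hΛ2⟩ := riesz_extension cone f
    (by
      intro g hg
      apply hpos
      · intro y; exact mul_nonneg (hg y) (wt_nonneg x y)
      · change g.1 x * wt x x = 0
        rw [wt_self, mul_zero])
    (by
      intro g
      refine ⟨⟨‖g‖ • (1 : BoundedContinuousFunction (Euc d) ℝ), W.smul_mem _ h1W⟩, fun y => ?_⟩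
      have := g.norm_coe_le_norm y
      rw [Real.norm_eq_abs] at this
      have h2 := (abs_le.1 this).1
      change 0 ≤ (‖g‖ • (1 : BoundedContinuousFunction (Euc d) ℝ) + g) y
      simp
      linarith)
  let toV : CompactlySupportedContinuousMap (Euc d) ℝ → BoundedContinuousFunction (Euc d) ℝ := fun g =>
    BoundedContinuousFunction.ofNormedAddCommGroup g g.continuous
      (g.continuous.bounded_above_of_compact_support g.hasCompactSupport).choose
      (g.continuous.bounded_above_of_compact_support g.hasCompactSupport).choose_spec
  have htoV : ∀ g y, toV g y = g y := fun g y => rfl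
  let Λc : CompactlySupportedContinuousMap (Euc d) ℝ →ₚ[ℝ] ℝ :=
    PositiveLinearMap.mk₀
      { toFun := fun g => Λ (toV g)
        map_add' := by
          intro a b
          rw [← map_add]; congr 1
        map_smul' := by
          intro c a
          rw [RingHom.id_apply, ← map_smul]; congr 1 }
      (fun g hg => hΛ2 _ fun y => hg y)
  have hΛc : ∀ g, Λc g = Λ (toV g) := fun g => rfl
  refine ⟨RealRMK.rieszMeasure Λc, ⟨?_⟩, ?_⟩
  · rw [isOpen_univ.measure_eq_iSup_isCompact]
    refine lt_of_le_of_lt (b := ENNReal.ofReal (Λ 1)) ?_ ENNReal.ofReal_lt_top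
    refine iSup_le fun Kc => iSup_le fun _ => iSup_le fun hKc => ?_
    obtain ⟨g, hg1, hg2, hg3, hg4⟩ := exists_continuousMap_one_of_isCompact_subset_isOpen hKc
      isOpen_univ (subset_univ Kc)
    refine (RealRMK.rieszMeasure_le_of_eq_one (f := ⟨g, hg2⟩) Λc
      (fun y => (hg4 y).1) hKc (fun y hy => hg1 hy)).trans ?_
    apply ENNReal.ofReal_le_ofReal
    rw [hΛc, ← sub_nonneg, ← map_sub]
    apply hΛ2
    intro y
    have := (hg4 y).2
    change 0 ≤ 1 - g y
    linarith
  · intro g hgc hgs f' hf'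
    let gc : CompactlySupportedContinuousMap (Euc d) ℝ := ⟨⟨g, hgc⟩, hgs⟩
    have h1 := RealRMK.integral_rieszMeasure Λc gc
    have hmem : toV gc ∈ W := by
      have := f'.isC2b
      rw [show f'.fn = _ from funext hf'] at this
      exact this
    have h2 := hΛ1 ⟨toV gc, hmem⟩
    have h3 : T ⟨toV gc, hmem⟩ = f' := C2b.ext fun y => (hf' y).symm
    rw [← h3]
    change _ = ∫ y, gc y ∂_
    rw [h1]
    exact h2.symm

lemma integrable_of_le {x : Euc d} {μ : Measure (Euc d)}
    (hμ : (∫⁻ y, ENNReal.ofReal (min 1 (‖y - x‖ ^ 2)) ∂μ) < ⊤) {w : Euc d → ℝ}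
    (hw : Measurable w) (C : ℝ) (hC : ∀ y, |w y| ≤ C * min 1 (‖y - x‖ ^ 2)) :
    Integrable w μ := by
  have hm : Measurable fun y : Euc d => min 1 (‖y - x‖ ^ 2) := by fun_prop
  have h1 : Integrable (fun y => min 1 (‖y - x‖ ^ 2)) μ := by
    refine ⟨hm.aestronglyMeasurable, ?_⟩
    rw [hasFiniteIntegral_iff_ofReal (Eventually.of_forall fun y => mn_nonneg x y)]
    exact hμ
  exact (h1.const_mul C).mono' hw.aestronglyMeasurable (Eventually.of_forall hC)

lemma bound_of_littleo {x : Euc d} {w : Euc d → ℝ} {M : ℝ} (hM : ∀ y, |w y| ≤ M)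
    (hx : w x = 0) (hlim : Tendsto (fun y => w y / ‖y - x‖ ^ 2) (𝓝 x) (𝓝 0)) :
    ∃ C, 0 ≤ C ∧ ∀ y, |w y| ≤ C * min 1 (‖y - x‖ ^ 2) := by
  have hM0 : 0 ≤ M := (abs_nonneg _).trans (hM x)
  obtain ⟨r, hr, hball⟩ := Metric.eventually_nhds_iff_ball.1
    ((Metric.tendsto_nhds.1 hlim) 1 one_pos)
  set r' := min r 1
  have hr' : 0 < r' := lt_min hr one_pos
  refine ⟨1 + M / r' ^ 2, by positivity, fun y => ?_⟩
  by_cases hyx : y = x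
  · subst hyx; simp [hx]
  have hpos : 0 < ‖y - x‖ := norm_pos_iff.2 (sub_ne_zero.2 hyx)
  rcases lt_or_ge ‖y - x‖ r' with h | h
  · have h1 := hball y (by rw [mem_ball, dist_eq_norm]; exact h.trans_le (min_le_left _ _))
    rw [dist_zero_right, norm_div, norm_pow, norm_norm, div_lt_one (by positivity)] at h1
    have h2 : ‖y - x‖ ≤ 1 := h.le.trans (min_le_right _ _)
    have h3 : ‖y - x‖ ^ 2 ≤ 1 := by nlinarith
    rw [min_eq_right h3]
    rw [Real.norm_eq_abs] at h1
    have : 0 ≤ M / r' ^ 2 * ‖y - x‖ ^ 2 := by positivity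
    nlinarith
  · have h1 : r' ^ 2 ≤ min 1 (‖y - x‖ ^ 2) := by
      apply le_min
      · have : r' ≤ 1 := min_le_right _ _
        nlinarith
      · exact pow_le_pow_left₀ hr'.le h 2
    have h2 : M = M / r' ^ 2 * r' ^ 2 := by field_simp
    have h3 : M / r' ^ 2 * r' ^ 2 ≤ M / r' ^ 2 * min 1 (‖y - x‖ ^ 2) :=
      mul_le_mul_of_nonneg_left h1 (by positivity)
    have := hM y
    have := mn_nonneg x y
    nlinarith

/-- large cutoff -/
def cut (d n : ℕ) : ContDiffBump (0 : Euc d) :=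
  ⟨2 * n + 1, 2 * n + 2, by positivity, by linarith⟩

lemma exists_mu (x : Euc d) (ℓ : C2b d →ₗ[ℝ] ℝ)
    (hpos : ∀ f : C2b d, (∀ y, 0 ≤ f.fn y) → f.fn x = 0 → 0 ≤ ℓ f)
    (ω : ℕ → ℝ) (hω : Tendsto ω atTop (𝓝 0))
    (htail : ∀ᶠ n : ℕ in atTop, ∀ f : C2b d, ∀ M : ℝ,
      (∀ y ∈ ball (0 : Euc d) (2 * n + 1), f.fn y = 0) → (∀ y, |f.fn y| ≤ M) →
        |ℓ f| ≤ ω n * M) :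
    ∃ μ : Measure (Euc d), μ {x} = 0 ∧
      (∫⁻ y, ENNReal.ofReal (min 1 (‖y - x‖ ^ 2)) ∂μ) < ⊤ ∧
      ∀ w : C2b d, w.fn x = 0 → Tendsto (fun y => w.fn y / ‖y - x‖ ^ 2) (𝓝 x) (𝓝 0) →
        ℓ w = ∫ y, w.fn y ∂μ := by
  obtain ⟨ν, hνf, hν⟩ := exists_nu x ℓ hpos
  have hwtm : Measurable (wt x) := (isC2b_wt x).1.continuous.measurable
  have hdm : Measurable (fun y => ENNReal.ofReal (wt x y)⁻¹) := hwtm.inv.ennreal_ofReal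
  let μ := (ν.restrict {x}ᶜ).withDensity (fun y => ENNReal.ofReal (wt x y)⁻¹)
  have hμx : μ {x} = 0 := by
    apply withDensity_absolutelyContinuous
    rw [Measure.restrict_apply (measurableSet_singleton x)]
    simp
  have hμf : (∫⁻ y, ENNReal.ofReal (min 1 (‖y - x‖ ^ 2)) ∂μ) < ⊤ := by
    have hm : Measurable fun y : Euc d => ENNReal.ofReal (min 1 (‖y - x‖ ^ 2)) := by fun_prop
    rw [lintegral_withDensity_eq_lintegral_mul _ hdm hm]
    refine lt_of_le_of_lt (b := ∫⁻ y, 1 ∂(ν.restrict {x}ᶜ)) ?_ (by simp [measure_lt_top])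
    refine lintegral_mono fun y => ?_
    simp only [Pi.mul_apply]
    rw [← ENNReal.ofReal_mul (inv_nonneg.2 (wt_nonneg x y)), ← ENNReal.ofReal_one]
    apply ENNReal.ofReal_le_ofReal
    rw [inv_mul_eq_div]
    exact div_le_one_of_le₀ (wt_ge x y) (wt_nonneg x y)
  refine ⟨μ, hμx, hμf, ?_⟩
  have key : ∀ w : C2b d, w.fn x = 0 → HasCompactSupport w.fn →
      Tendsto (fun y => w.fn y / ‖y - x‖ ^ 2) (𝓝 x) (𝓝 0) → ℓ w = ∫ y, w.fn y ∂μ := by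
    intro w hwx hwc hlim
    have hgc : Continuous (fun y => w.fn y / wt x y) := by
      rw [continuous_iff_continuousAt]
      intro y
      by_cases hyx : y = x
      · subst hyx
        have : Tendsto (fun z => w.fn z / wt y z) (𝓝 y) (𝓝 0) := by
          refine hlim.congr' ?_
          filter_upwards [Metric.ball_mem_nhds y one_pos] with z hz
          rw [wt_eq (by rw [mem_ball, dist_eq_norm] at hz; exact hz.le)]
        rw [ContinuousAt]
        simpa [hwx] using this
      · exact (w.isC2b.1.continuous.continuousAt).div
          ((isC2b_wt x).1.continuous.continuousAt) (wt_pos hyx).ne'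
    have hgs : HasCompactSupport (fun y => w.fn y / wt x y) := by
      simp only [div_eq_mul_inv]
      exact hwc.mul_right
    rw [hν _ hgc hgs w ?_]
    · rw [integral_withDensity_eq_integral_toReal_smul hdm (by simp)]
      rw [← setIntegral_eq_integral_of_forall_compl_eq_zero (s := {x}ᶜ)]
      · refine integral_congr_ae (Eventually.of_forall fun y => ?_)
        simp only [smul_eq_mul]
        rw [ENNReal.toReal_ofReal (inv_nonneg.2 (wt_nonneg x y)), inv_mul_eq_div]
      · intro y hy
        have : y = x := by simpa using hy
        rw [this, hwx, zero_div]
    · intro y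
      by_cases hyx : y = x
      · rw [hyx, hwx]; simp
      · rw [div_mul_cancel₀ _ (wt_pos hyx).ne']
  intro w hwx hlim
  obtain ⟨M, hM⟩ := w.isC2b.2
  have hM1 : ∀ y, |w.fn y| ≤ M := fun y => (hM y).1
  have hM0 : 0 ≤ M := (abs_nonneg _).trans (hM1 x)
  obtain ⟨C, hC0, hC⟩ := bound_of_littleo hM1 hwx hlim
  have hcs : ∀ n, HasCompactSupport (fun y => cut d n y * w.fn y) := fun n =>
    (cut d n).hasCompactSupport.mul_right
  let wn : ℕ → C2b d := fun n => C2b.mk (fun y => cut d n y * w.fn y)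
    (isC2b_of_compact ((cut d n).contDiff.mul w.isC2b.1) (hcs n))
  have hc01 : ∀ n y, 0 ≤ cut d n y ∧ cut d n y ≤ 1 := fun n y =>
    ⟨(cut d n).nonneg, (cut d n).le_one⟩
  have hone : ∀ (n : ℕ) (y : Euc d), y ∈ ball (0 : Euc d) (2 * (n : ℝ) + 1) → cut d n y = 1 := fun n y hy =>
    (cut d n).one_of_mem_closedBall (ball_subset_closedBall hy)
  have habs : ∀ n y, |cut d n y * w.fn y| ≤ |w.fn y| := by
    intro n y
    rw [abs_mul, abs_of_nonneg (hc01 n y).1]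
    exact mul_le_of_le_one_left (abs_nonneg _) (hc01 n y).2
  have h1 : ∀ n, ℓ (wn n) = ∫ y, cut d n y * w.fn y ∂μ := by
    intro n
    refine key (wn n) (by simp [wn, hwx]) (hcs n) ?_
    refine squeeze_zero_norm (fun y => ?_) (tendsto_norm_zero.comp hlim)
    simp only [Function.comp, norm_div, wn, C2b.fn_mk]
    gcongr
    exact habs n y
  have h2 : Tendsto (fun n => ∫ y, cut d n y * w.fn y ∂μ) atTop (𝓝 (∫ y, w.fn y ∂μ)) := by
    refine tendsto_integral_of_dominated_convergence (fun y => |w.fn y|) ?_ ?_ ?_ ?_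
    · intro n
      exact (((cut d n).continuous.mul w.isC2b.1.continuous)).aestronglyMeasurable
    · exact (integrable_of_le hμf w.isC2b.1.continuous.measurable C hC).abs
    · intro n
      exact Eventually.of_forall fun y => habs n y
    · refine Eventually.of_forall fun y => ?_
      refine tendsto_const_nhds.congr' ?_
      obtain ⟨N, hN⟩ := exists_nat_gt ‖y‖
      filter_upwards [eventually_ge_atTop N] with n hn
      rw [hone n y, one_mul]
      have : (N : ℝ) ≤ n := by exact_mod_cast hn
      rw [mem_ball_zero_iff]
      linarith [norm_nonneg y]
  have h3 : Tendsto (fun n => ℓ (wn n)) atTop (𝓝 (ℓ w)) := by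
    rw [tendsto_iff_norm_sub_tendsto_zero]
    have hz : Tendsto (fun n => ω n * M) atTop (𝓝 0) := by simpa using hω.mul_const M
    refine squeeze_zero' (Eventually.of_forall fun _ => norm_nonneg _) ?_ hz
    filter_upwards [htail] with n hn
    rw [← map_sub]
    apply hn
    · intro y hy
      simp [wn, hone n y hy]
    · intro y
      have e : (wn n - w).fn y = - ((1 - cut d n y) * w.fn y) := by
        simp [wn]; ring
      rw [e, abs_neg, abs_mul, abs_of_nonneg (sub_nonneg.2 (hc01 n y).2)]
      refine (mul_le_of_le_one_left (abs_nonneg _) ?_).trans (hM1 y)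
      linarith [(hc01 n y).1]
  simp only [h1] at h3
  exact tendsto_nhds_unique h3 h2

lemma exp1 (g : Euc d →L[ℝ] ℝ) (z : Euc d) :
    g z = ∑ i, z i * g (EuclideanSpace.single i (1:ℝ)) := by
  have h := (EuclideanSpace.basisFun (Fin d) ℝ).sum_repr z
  conv_lhs => rw [← h]
  simp [map_sum]

lemma exp2 (H : Euc d →L[ℝ] Euc d →L[ℝ] ℝ) (z : Euc d) :
    H z z = ∑ i, ∑ j, z i * z j *
      H (EuclideanSpace.single i (1:ℝ)) (EuclideanSpace.single j (1:ℝ)) := by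
  have h1 := exp1 (H.flip z) z
  simp only [ContinuousLinearMap.flip_apply] at h1
  rw [h1]
  refine Finset.sum_congr rfl fun i _ => ?_
  rw [exp1 (H _) z, Finset.mul_sum]
  refine Finset.sum_congr rfl fun j _ => ?_
  ring

lemma contDiff_lin (x : Euc d) (g : Euc d →L[ℝ] ℝ) : ContDiff ℝ 2 (fun y => g (y - x)) :=
  g.contDiff.comp (contDiff_id.sub contDiff_const)

lemma contDiff_quad (x : Euc d) (H : Euc d →L[ℝ] Euc d →L[ℝ] ℝ) :
    ContDiff ℝ 2 (fun y => H (y - x) (y - x)) :=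
  (H.contDiff.comp (contDiff_id.sub contDiff_const)).clm_apply (contDiff_id.sub contDiff_const)

/-- truncated linear function -/
def Pm (x : Euc d) (g : Euc d →L[ℝ] ℝ) : C2b d :=
  C2b.mk (fun y => bmp x y * g (y - x)) (isC2b_bmp_mul x (contDiff_lin x g))

/-- truncated quadratic function -/
def Qm (x : Euc d) (H : Euc d →L[ℝ] Euc d →L[ℝ] ℝ) : C2b d :=
  C2b.mk (fun y => bmp x y * H (y - x) (y - x)) (isC2b_bmp_mul x (contDiff_quad x H))

/-- truncated coordinate -/
def Pc (x : Euc d) (i : Fin d) : C2b d :=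
  C2b.mk (fun y => bmp x y * (y - x) i) (isC2b_bmp_mul x (contDiff_coord x i))

/-- truncated product of coordinates -/
def Qc (x : Euc d) (i j : Fin d) : C2b d :=
  C2b.mk (fun y => bmp x y * ((y - x) i * (y - x) j))
    (isC2b_bmp_mul x ((contDiff_coord x i).mul (contDiff_coord x j)))

lemma Pm_eq (x : Euc d) (g : Euc d →L[ℝ] ℝ) :
    Pm x g = ∑ i, g (EuclideanSpace.single i (1:ℝ)) • Pc x i := by
  apply C2b.ext
  intro y
  rw [C2b.fn_sum]
  simp only [C2b.fn_smul, Pm, Pc, C2b.fn_mk]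
  rw [exp1 g, Finset.mul_sum]
  exact Finset.sum_congr rfl fun i _ => by ring

lemma Qm_eq (x : Euc d) (H : Euc d →L[ℝ] Euc d →L[ℝ] ℝ) :
    Qm x H = ∑ i, ∑ j,
      H (EuclideanSpace.single i (1:ℝ)) (EuclideanSpace.single j (1:ℝ)) • Qc x i j := by
  apply C2b.ext
  intro y
  simp only [C2b.fn_sum, C2b.fn_smul, Qm, Qc, C2b.fn_mk]
  rw [exp2 H, Finset.mul_sum]
  refine Finset.sum_congr rfl fun i _ => ?_
  rw [Finset.mul_sum]
  exact Finset.sum_congr rfl fun i _ => by ring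

lemma bmp_le (x y : Euc d) : bmp x y * ‖y - x‖ ^ 2 ≤ 4 * min 1 (‖y - x‖ ^ 2) := by
  have h0 : 0 ≤ bmp x y := (bmp x).nonneg
  have h1 : bmp x y ≤ 1 := (bmp x).le_one
  rcases le_total ‖y - x‖ 2 with h | h
  · have h3 : ‖y - x‖ ^ 2 ≤ 4 := by nlinarith [norm_nonneg (y - x)]
    rw [mul_min_of_nonneg _ _ (by norm_num : (0:ℝ) ≤ 4)]
    apply le_min <;> nlinarith [sq_nonneg ‖y - x‖]
  · have : bmp x y = 0 := (bmp x).zero_of_le_dist (by rw [dist_eq_norm]; exact h)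
    rw [this, zero_mul]
    have := mn_nonneg x y
    linarith

lemma coord_le (z : Euc d) (i : Fin d) : |z i| ≤ ‖z‖ := PiLp.norm_apply_le z i

lemma integrable_Qc {x : Euc d} {μ : Measure (Euc d)}
    (hμ : (∫⁻ y, ENNReal.ofReal (min 1 (‖y - x‖ ^ 2)) ∂μ) < ⊤) (i j : Fin d) :
    Integrable (Qc x i j).fn μ := by
  refine integrable_of_le hμ (Qc x i j).isC2b.1.continuous.measurable 4 fun y => ?_
  refine le_trans ?_ (bmp_le x y)
  simp only [Qc, C2b.fn_mk, abs_mul]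
  rw [abs_of_nonneg (bmp x).nonneg, sq]
  have := coord_le (y - x) i
  have := coord_le (y - x) j
  have h0 : 0 ≤ bmp x y := (bmp x).nonneg
  gcongr

lemma integrable_Pc {x : Euc d} {μ : Measure (Euc d)}
    (hμ : (∫⁻ y, ENNReal.ofReal (min 1 (‖y - x‖ ^ 2)) ∂μ) < ⊤) (i : Fin d) :
    Integrable (fun y => (Pc x i).fn y - indicator (ball x 1) (fun z => (z - x) i) y) μ := by
  refine integrable_of_le hμ ?_ 2 fun y => ?_
  · exact (Pc x i).isC2b.1.continuous.measurable.sub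
      ((contDiff_coord x i).continuous.measurable.indicator measurableSet_ball)
  · by_cases hy : y ∈ ball x 1
    · rw [indicator_of_mem hy]
      rw [mem_ball, dist_eq_norm] at hy
      simp only [Pc, C2b.fn_mk, bmp_one hy.le, one_mul, sub_self, abs_zero]
      have := mn_nonneg x y
      linarith
    · rw [indicator_of_notMem hy]
      rw [mem_ball, dist_eq_norm, not_lt] at hy
      rw [min_eq_left (by nlinarith)]
      simp only [Pc, C2b.fn_mk, sub_zero, abs_mul]
      have h0 : 0 ≤ bmp x y := (bmp x).nonneg
      have h1 : bmp x y ≤ 1 := (bmp x).le_one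
      rw [abs_of_nonneg h0]
      rcases le_total ‖y - x‖ 2 with h | h
      · have := coord_le (y - x) i
        nlinarith [abs_nonneg ((y - x) i)]
      · have : bmp x y = 0 := (bmp x).zero_of_le_dist (by rw [dist_eq_norm]; exact h)
        rw [this]; norm_num

lemma Qm_nonneg (x : Euc d) (ℓ : C2b d →ₗ[ℝ] ℝ)
    (hpos : ∀ f : C2b d, (∀ y, 0 ≤ f.fn y) → f.fn x = 0 → 0 ≤ ℓ f)
    (μ : Measure (Euc d))
    (hrep : ∀ w : C2b d, w.fn x = 0 → Tendsto (fun y => w.fn y / ‖y - x‖ ^ 2) (𝓝 x) (𝓝 0) →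
        ℓ w = ∫ y, w.fn y ∂μ)
    (H : Euc d →L[ℝ] Euc d →L[ℝ] ℝ) (hH : ∀ z, 0 ≤ H z z)
    (hIntg : Integrable (Qm x H).fn μ) (hμx : μ {x} = 0) :
    0 ≤ ℓ (Qm x H) - ∫ y, (Qm x H).fn y ∂μ := by
  have hε : ∀ n : ℕ, (0:ℝ) < 1 / ((n:ℝ) + 1) := fun n => by positivity
  have hden : ∀ (n : ℕ) (y : Euc d), 0 < 1 / ((n:ℝ) + 1) + ‖y - x‖ ^ 2 := fun n y => by
    have := hε n; positivity
  let g : ℕ → Euc d → ℝ := fun n y =>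
    H (y - x) (y - x) * (‖y - x‖ ^ 2 / (1 / ((n:ℝ) + 1) + ‖y - x‖ ^ 2))
  have hg : ∀ n, ContDiff ℝ 2 (g n) := fun n =>
    (contDiff_quad x H).mul ((contDiff_nsq x).div (contDiff_const.add (contDiff_nsq x))
      (fun y => (hden n y).ne'))
  let w : ℕ → C2b d := fun n => C2b.mk (fun y => bmp x y * g n y) (isC2b_bmp_mul x (hg n))
  have hq0 : ∀ y, 0 ≤ (Qm x H).fn y := fun y => mul_nonneg (bmp x).nonneg (hH _)
  have hw : ∀ n y, (w n).fn y =
      (Qm x H).fn y * (‖y - x‖ ^ 2 / (1 / ((n:ℝ) + 1) + ‖y - x‖ ^ 2)) := fun n y => by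
    simp only [w, g, Qm, C2b.fn_mk]; ring
  have hf1 : ∀ (n : ℕ) (y : Euc d), ‖y - x‖ ^ 2 / (1 / ((n:ℝ) + 1) + ‖y - x‖ ^ 2) ≤ 1 := fun n y => by
    rw [div_le_one (hden n y)]; linarith [hε n]
  have hf0 : ∀ (n : ℕ) (y : Euc d), 0 ≤ ‖y - x‖ ^ 2 / (1 / ((n:ℝ) + 1) + ‖y - x‖ ^ 2) :=
    fun n y => div_nonneg (sq_nonneg _) (hden n y).le
  have hw0 : ∀ n y, 0 ≤ (w n).fn y := fun n y => by
    rw [hw]; exact mul_nonneg (hq0 y) (hf0 n y)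
  have hwle : ∀ n y, (w n).fn y ≤ (Qm x H).fn y := fun n y => by
    rw [hw]; exact mul_le_of_le_one_right (hq0 y) (hf1 n y)
  have h1 : ∀ n, ℓ (w n) = ∫ y, (w n).fn y ∂μ := by
    intro n
    refine hrep _ (by simp [hw]) ?_
    have hc : Tendsto (fun y => (Qm x H).fn y / (1 / ((n:ℝ) + 1) + ‖y - x‖ ^ 2)) (𝓝 x) (𝓝 0) := by
      have : ContinuousAt (fun y => (Qm x H).fn y / (1 / ((n:ℝ) + 1) + ‖y - x‖ ^ 2)) x :=
        ((Qm x H).isC2b.1.continuous.continuousAt).div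
          ((contDiff_const.add (contDiff_nsq x)).continuous.continuousAt) (hden n x).ne'
      have h2 := this.tendsto
      simpa [Qm] using h2
    refine squeeze_zero_norm (fun y => ?_) (tendsto_norm_zero.comp hc)
    simp only [Function.comp]
    rw [hw]
    by_cases hyx : y = x
    · subst hyx; simp [Qm]
    have hp : 0 < ‖y - x‖ := norm_pos_iff.2 (sub_ne_zero.2 hyx)
    apply le_of_eq
    congr 1
    field_simp
  have h2 : Tendsto (fun n => ∫ y, (w n).fn y ∂μ) atTop (𝓝 (∫ y, (Qm x H).fn y ∂μ)) := by
    refine tendsto_integral_of_dominated_convergence (Qm x H).fn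
      (fun n => (w n).isC2b.1.continuous.aestronglyMeasurable) hIntg ?_ ?_
    · intro n
      refine Eventually.of_forall fun y => ?_
      rw [Real.norm_eq_abs, abs_of_nonneg (hw0 n y)]
      exact hwle n y
    · refine Eventually.of_forall fun y => ?_
      simp only [hw]
      by_cases hyx : y = x
      · subst hyx; simp [Qm]
      have hp : 0 < ‖y - x‖ := norm_pos_iff.2 (sub_ne_zero.2 hyx)
      have h3 : Tendsto (fun n : ℕ => 1 / ((n:ℝ) + 1) + ‖y - x‖ ^ 2) atTop
          (𝓝 (0 + ‖y - x‖ ^ 2)) :=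
        tendsto_one_div_add_atTop_nhds_zero_nat.add_const _
      rw [zero_add] at h3
      have h4 := ((tendsto_const_nhds (x := ‖y - x‖ ^ 2)).div h3 (by positivity)).const_mul
        ((Qm x H).fn y)
      rwa [div_self (by positivity), mul_one] at h4
  have h3 : ∀ n, ∫ y, (w n).fn y ∂μ ≤ ℓ (Qm x H) := by
    intro n
    rw [← h1]
    have := hpos (Qm x H - w n) (fun y => by simpa using hwle n y)
      (by simp [hw, Qm])
    rw [map_sub] at this
    linarith
  have := le_of_tendsto' h2 h3
  linarith

lemma exists_levy (x : Euc d) (ℓ : C2b d →ₗ[ℝ] ℝ)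
    (hpos : ∀ f : C2b d, (∀ y, 0 ≤ f.fn y) → f.fn x = 0 → 0 ≤ ℓ f)
    (ω : ℕ → ℝ) (hω : Tendsto ω atTop (𝓝 0))
    (htail : ∀ᶠ n : ℕ in atTop, ∀ f : C2b d, ∀ M : ℝ,
      (∀ y ∈ ball (0 : Euc d) (2 * n + 1), f.fn y = 0) → (∀ y, |f.fn y| ≤ M) →
        |ℓ f| ≤ ω n * M) :
    ∃ D : LevyData d, D.base = x ∧
      D.A.IsSymm ∧ D.A.PosSemidef ∧ D.μ {x} = 0 ∧
      (∫⁻ y, ENNReal.ofReal (min 1 (‖y - x‖ ^ 2)) ∂D.μ) < ⊤ ∧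
      ∀ w : C2b d, ℓ w = D.apply w.fn := by
  obtain ⟨μ, hμx, hμ, hrep⟩ := exists_mu x ℓ hpos ω hω htail
  let a : Fin d → Fin d → ℝ := fun i j => (1/2) * (ℓ (Qc x i j) - ∫ y, (Qc x i j).fn y ∂μ)
  let b : Fin d → ℝ := fun i => ℓ (Pc x i) -
    ∫ y, ((Pc x i).fn y - indicator (ball x 1) (fun z => (z - x) i) y) ∂μ
  have hQint : ∀ H, Integrable (Qm x H).fn μ := by
    intro H
    have : (Qm x H).fn = fun y => ∑ i, ∑ j,
        H (EuclideanSpace.single i (1:ℝ)) (EuclideanSpace.single j (1:ℝ)) * (Qc x i j).fn y := by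
      funext y
      rw [Qm_eq]
      simp only [C2b.fn_sum, C2b.fn_smul]
    rw [this]
    exact integrable_finsetSum _ fun i _ => integrable_finsetSum _ fun j _ =>
      (integrable_Qc hμ i j).const_mul _
  have hQ : ∀ H : Euc d →L[ℝ] Euc d →L[ℝ] ℝ,
      (1/2) * (ℓ (Qm x H) - ∫ y, (Qm x H).fn y ∂μ) = ∑ i, ∑ j, a i j *
        H (EuclideanSpace.single i (1:ℝ)) (EuclideanSpace.single j (1:ℝ)) := by
    intro H
    rw [Qm_eq]
    simp only [C2b.fn_sum, C2b.fn_smul, map_sum, map_smul, smul_eq_mul]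
    rw [integral_finsetSum _ fun i _ => integrable_finsetSum _ fun j _ =>
      (integrable_Qc hμ i j).const_mul _]
    rw [← Finset.sum_sub_distrib, Finset.mul_sum]
    refine Finset.sum_congr rfl fun i _ => ?_
    rw [integral_finsetSum _ fun j _ => (integrable_Qc hμ i j).const_mul _]
    rw [← Finset.sum_sub_distrib, Finset.mul_sum]
    refine Finset.sum_congr rfl fun j _ => ?_
    rw [integral_const_mul]
    simp only [a]
    ring
  have hPind : ∀ (g : Euc d →L[ℝ] ℝ) y, (Pm x g).fn y -
      indicator (ball x 1) (fun z => g (z - x)) y = ∑ i, g (EuclideanSpace.single i (1:ℝ)) *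
        ((Pc x i).fn y - indicator (ball x 1) (fun z => (z - x) i) y) := by
    intro g y
    rw [Pm_eq]
    simp only [C2b.fn_sum, C2b.fn_smul, mul_sub, Finset.sum_sub_distrib]
    congr 1
    by_cases hy : y ∈ ball x 1
    · simp only [indicator_of_mem hy]
      rw [exp1 g]
      exact Finset.sum_congr rfl fun i _ => mul_comm _ _
    · simp [indicator_of_notMem hy]
  have hPint : ∀ g : Euc d →L[ℝ] ℝ, Integrable (fun y => (Pm x g).fn y -
      indicator (ball x 1) (fun z => g (z - x)) y) μ := by
    intro g
    simp only [hPind]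
    exact integrable_finsetSum _ fun i _ => (integrable_Pc hμ i).const_mul _
  have hP : ∀ g : Euc d →L[ℝ] ℝ, ℓ (Pm x g) - ∫ y, ((Pm x g).fn y -
      indicator (ball x 1) (fun z => g (z - x)) y) ∂μ = g (WithLp.toLp 2 b) := by
    intro g
    simp only [hPind]
    rw [integral_finsetSum _ fun i _ => (integrable_Pc hμ i).const_mul _, Pm_eq]
    simp only [map_sum, map_smul, smul_eq_mul, integral_const_mul]
    rw [exp1 g, ← Finset.sum_sub_distrib]
    refine Finset.sum_congr rfl fun i _ => ?_
    simp only [b]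
    ring
  have hsym : ∀ i j, a i j = a j i := by
    intro i j
    have : Qc x i j = Qc x j i := by
      apply C2b.ext; intro y; simp only [Qc, C2b.fn_mk]; ring
    simp only [a, this]
  let one : C2b d := C2b.mk (fun _ => 1) (isC2b_const 1)
  refine ⟨⟨x, Matrix.of a, WithLp.toLp 2 b, ℓ one, μ⟩, rfl, ?_, ?_, hμx, hμ, ?_⟩
  · ext i j
    exact hsym j i
  · refine Matrix.PosSemidef.of_dotProduct_mulVec_nonneg ?_ ?_
    · ext i j
      simpa using hsym j i
    · intro ξ
      let φ : Euc d →L[ℝ] ℝ := innerSL ℝ (WithLp.toLp 2 ξ)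
      have hφ : ∀ i, φ (EuclideanSpace.single i (1:ℝ)) = ξ i := by
        intro i
        simp only [φ, innerSL_apply_apply]
        rw [EuclideanSpace.inner_single_right]
        simp
      let H : Euc d →L[ℝ] Euc d →L[ℝ] ℝ := φ.smulRight φ
      have hH : ∀ u v, H u v = φ u * φ v := fun u v => by simp [H]
      have h0 := Qm_nonneg x ℓ hpos μ hrep H (fun z => by rw [hH]; exact mul_self_nonneg _)
        (hQint H) hμx
      have h1 := hQ H
      have e : star ξ ⬝ᵥ (Matrix.of a).mulVec ξ = ∑ i, ∑ j, a i j *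
          H (EuclideanSpace.single i (1:ℝ)) (EuclideanSpace.single j (1:ℝ)) := by
        simp only [dotProduct, Matrix.mulVec, Matrix.of_apply, hH, hφ, Finset.mul_sum]
        refine Finset.sum_congr rfl fun i _ => Finset.sum_congr rfl fun j _ => ?_
        simp
        ring
      rw [e, ← h1]
      linarith
  · intro w
    set G := fderiv ℝ w.fn x with hG
    set H := fderiv ℝ (fderiv ℝ w.fn) x with hHd
    let R : C2b d := w - w.fn x • one - Pm x G - (1/2 : ℝ) • Qm x H
    have hR : ∀ y, R.fn y = w.fn y - w.fn x - (Pm x G).fn y - (1/2) * (Qm x H).fn y := by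
      intro y
      simp [R, one]
    have hRx : R.fn x = 0 := by simp [hR, Pm, Qm]
    have hRlim : Tendsto (fun y => R.fn y / ‖y - x‖ ^ 2) (𝓝 x) (𝓝 0) := by
      refine (taylor2 w.isC2b.1 x).congr' ?_
      filter_upwards [Metric.ball_mem_nhds x one_pos] with y hy
      rw [mem_ball, dist_eq_norm] at hy
      rw [hR]
      simp only [Pm, Qm, C2b.fn_mk, bmp_one hy.le, one_mul]
      rfl
    obtain ⟨M, hM⟩ := R.isC2b.2
    obtain ⟨C, hC0, hC⟩ := bound_of_littleo (fun y => (hM y).1) hRx hRlim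
    have hRint : Integrable R.fn μ :=
      integrable_of_le hμ R.isC2b.1.continuous.measurable C hC
    have h1 := hrep R hRx hRlim
    have h2 : ℓ R = ℓ w - w.fn x * ℓ one - ℓ (Pm x G) - (1/2) * ℓ (Qm x H) := by
      simp [R]
    have h3 : ∫ y, (w.fn y - w.fn x - indicator (ball x 1) (fun z => G (z - x)) y) ∂μ
        = ∫ y, R.fn y ∂μ + ∫ y, ((Pm x G).fn y - indicator (ball x 1) (fun z => G (z - x)) y) ∂μ
          + (1/2) * ∫ y, (Qm x H).fn y ∂μ := by
      have hs : Integrable (fun y => R.fn y + ((Pm x G).fn y -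
          indicator (ball x 1) (fun z => G (z - x)) y)) μ := hRint.add (hPint G)
      rw [← integral_const_mul, ← integral_add hRint (hPint G),
        ← integral_add hs ((hQint H).const_mul _)]
      refine integral_congr_ae (Eventually.of_forall fun y => ?_)
      simp only [hR]
      ring
    have h4 := hP G
    have h5 := hQ H
    have h6 : ∀ i j, iteratedFDeriv ℝ 2 w.fn x
        ![EuclideanSpace.single i (1:ℝ), EuclideanSpace.single j (1:ℝ)] =
        H (EuclideanSpace.single i (1:ℝ)) (EuclideanSpace.single j (1:ℝ)) := by
      intro i j
      rw [iteratedFDeriv_two_apply]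
      simp [H]
    simp only [LevyData.apply, Matrix.of_apply, h6]
    rw [← hG, h3, ← h4, ← h5]
    linarith

lemma biSup_zero {S : Set (Euc d)} {F : Euc d → ℝ} (h : ∀ x ∈ S, F x = 0) :
    ⨆ x ∈ S, F x = 0 := by
  have : ∀ x, (⨆ (_ : x ∈ S), F x) = 0 := by
    intro x
    by_cases hx : x ∈ S
    · simp [hx, h x hx]
    · simp [hx]
  simp [this]

lemma localC2Norm_zero {r : ℝ} {u : Euc d → ℝ} (h : ∀ y ∈ ball (0 : Euc d) (r + 1), u y = 0) :
    localC2Norm r u = 0 := by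
  have he : ∀ y ∈ closedBall (0 : Euc d) r, u =ᶠ[𝓝 y] (fun _ => 0) := by
    intro y hy
    have : y ∈ ball (0 : Euc d) (r + 1) := closedBall_subset_ball (by linarith) hy
    filter_upwards [isOpen_ball.mem_nhds this] with z hz using h z hz
  unfold localC2Norm localSup localGradSup localHessSup
  rw [biSup_zero, biSup_zero, biSup_zero]
  · simp
  · intro y hy
    rw [((he y hy).iteratedFDeriv ℝ 2).eq_of_nhds, iteratedFDeriv_const_of_ne (by norm_num)]
    simp
  · intro y hy
    rw [(he y hy).fderiv_eq]
    simp
  · intro y hy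
    rw [(he y hy).eq_of_nhds]
    simp

lemma C2Norm_const_zero : C2Norm (fun _ : Euc d => (0:ℝ)) = 0 := by
  have := C2Norm_cmul (d := d) (isC2b_const 0) 0
  simpa using this

/-- the class of admissible operators -/
def goodOps (d : ℕ) (K₀ : ℝ) : Set ((Euc d → ℝ) → Euc d → ℝ) :=
  {L | (∀ u v, IsC2b u → IsC2b v → ∀ x : Euc d,
            L (fun y => u y + v y) x = L u x + L v x) ∧
        (∀ (c : ℝ) (u : Euc d → ℝ), IsC2b u → ∀ x : Euc d,
            L (fun y => c * u y) x = c * L u x) ∧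
        (∀ u, IsC2b u → ∀ x : Euc d, |L u x| ≤ K₀ * C2Norm u) ∧
        (∀ u, IsC2b u → IsCb (L u)) ∧
        (∀ x : Euc d, ∃ D : LevyData d, D.base = x ∧
            D.A.IsSymm ∧ D.A.PosSemidef ∧ D.μ {x} = 0 ∧
            (∫⁻ y, ENNReal.ofReal (min 1 (‖y - x‖ ^ 2)) ∂D.μ) < ⊤ ∧
            ∀ w, IsC2b w → L w x = D.apply w)}

lemma exists_good (d : ℕ) (K₀ : ℝ) (hK₀ : 0 ≤ K₀)
    (I : (Euc d → ℝ) → Euc d → ℝ)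
    (hLip : LipWith K₀ IsC2b C2Norm I)
    (hGCP : GCP IsC2b I)
    (hloc : Locality IsC2b localC2Norm I)
    (hequi : EquiContAssumption I) (u v : Euc d → ℝ) (hu : IsC2b u) (hv : IsC2b v) (x₀ : Euc d) :
    ∃ L ∈ goodOps d K₀, I u x₀ ≤ I v x₀ + L (fun y => u y - v y) x₀ := by
  let J : C2b d → Euc d → ℝ := fun w => I w.fn
  have hJL : ∀ u v x, |J u x - J v x| ≤ K₀ * ‖u - v‖ := fun u v x =>
    hLip u.fn v.fn u.isC2b v.isC2b x
  have hJe : ∀ S : Set (C2b d), IsCompact S → ∀ x, ∀ ε > 0, ∃ δ > 0, ∀ u ∈ S, ∀ v ∈ S, ∀ y,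
      dist y x < δ → |(J (v + u) y - J v y) - (J (v + u) x - J v x)| ≤ ε * ‖u‖ := by
    intro S hS x ε hε
    obtain ⟨δ, hδ, hh⟩ := hequi _ (seqCompact_image hS) x ε hε
    refine ⟨δ, hδ, fun u hu v hv y hy => ?_⟩
    rcases (norm_nonneg u).eq_or_lt with h0 | h0
    · have h1 : ∀ z, J (v + u) z = J v z := by
        intro z
        have := hJL (v + u) v z
        rw [add_sub_cancel_left, ← h0, mul_zero] at this
        exact sub_eq_zero.1 (abs_nonpos_iff.1 this)
      rw [h1, h1, ← h0]; simp
    · have hne : u.fn ≠ 0 := by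
        intro h
        have : ‖u‖ = 0 := by
          rw [C2b.norm_def, h]
          exact C2Norm_const_zero
        exact h0.ne' this
      have h2 := hh u.fn v.fn ⟨u, hu, rfl⟩ ⟨v, hv, rfl⟩ hne y hy
      rw [← sub_div, abs_div, abs_of_pos (show 0 < C2Norm u.fn from h0)] at h2
      rw [div_lt_iff₀ (show 0 < C2Norm u.fn from h0)] at h2
      exact h2.le
  obtain ⟨T, hTc, hTq, hTx⟩ := exists_linear J K₀ hK₀ hJL hJe (C2b.mk v hv)
    (C2b.mk u hu - C2b.mk v hv) x₀
  have hTb : ∀ f x, |T f x| ≤ K₀ * ‖f‖ := by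
    have h1 : ∀ f x, T f x ≤ K₀ * ‖f‖ := by
      intro f x
      refine hTq f x _ fun p t ht => ?_
      have := (le_abs_self _).trans (hJL (p + t • f) p x)
      rw [add_sub_cancel_left, norm_smul, Real.norm_eq_abs, abs_of_pos ht] at this
      linarith
    intro f x
    rw [abs_le]
    refine ⟨?_, h1 f x⟩
    have := h1 (-f) x
    rw [map_neg, norm_neg, Pi.neg_apply] at this
    linarith
  classical
  let L : (Euc d → ℝ) → Euc d → ℝ := fun w => if h : IsC2b w then T (C2b.mk w h) else 0
  have hL : ∀ w (h : IsC2b w), L w = T (C2b.mk w h) := fun w h => by simp [L, h]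
  refine ⟨L, ⟨?_, ?_, ?_, ?_, ?_⟩, ?_⟩
  · intro a b ha hb x
    rw [hL _ ha, hL _ hb, hL _ (ha.add hb), ← Pi.add_apply, ← map_add]
    rfl
  · intro c a ha x
    rw [hL _ ha, hL _ (ha.cmul c), ← smul_eq_mul, ← Pi.smul_apply, ← map_smul]
    rfl
  · intro a ha x
    rw [hL _ ha]
    exact hTb _ x
  · intro a ha
    rw [hL _ ha]
    exact ⟨hTc _, _, hTb _⟩
  · intro x
    let ℓ : C2b d →ₗ[ℝ] ℝ := (LinearMap.proj x : (Euc d → ℝ) →ₗ[ℝ] ℝ) ∘ₗ T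
    have hℓ : ∀ f, ℓ f = T f x := fun f => rfl
    obtain ⟨C₀, ω, hωp, hω, r₀, hr⟩ := hloc
    have hpos : ∀ f : C2b d, (∀ y, 0 ≤ f.fn y) → f.fn x = 0 → 0 ≤ ℓ f := by
      intro f hf hfx
      have h1 : T (-f) x ≤ 0 := by
        refine hTq (-f) x 0 fun p t ht => ?_
        have := hGCP (p + t • (-f)).fn p.fn (C2b.isC2b _) p.isC2b (fun y => ?_) x ?_
        · simpa [J] using this
        · have := mul_nonneg ht.le (hf y)
          rw [smul_neg, ← sub_eq_add_neg, C2b.fn_sub, C2b.fn_smul]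
          linarith
        · rw [smul_neg, ← sub_eq_add_neg, C2b.fn_sub, C2b.fn_smul, hfx]
          simp
      rw [map_neg, Pi.neg_apply] at h1
      rw [hℓ]
      linarith
    have hω' : Tendsto (fun n : ℕ => |C₀| * |ω n|) atTop (𝓝 0) := by
      have h1 : Tendsto (fun n : ℕ => ω n) atTop (𝓝 0) :=
        hω.comp tendsto_natCast_atTop_atTop
      have h2 := h1.abs.const_mul |C₀|
      simpa using h2
    have htail : ∀ᶠ n : ℕ in atTop, ∀ f : C2b d, ∀ M : ℝ,
        (∀ y ∈ ball (0 : Euc d) (2 * n + 1), f.fn y = 0) → (∀ y, |f.fn y| ≤ M) →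
          |ℓ f| ≤ (|C₀| * |ω n|) * M := by
      obtain ⟨N, hN⟩ := exists_nat_ge (max r₀ ‖x‖)
      filter_upwards [eventually_ge_atTop N] with n hn f M hf0 hfM
      have hnN : (N : ℝ) ≤ n := by exact_mod_cast hn
      have hn1 : r₀ ≤ n := (le_max_left _ _).trans (hN.trans hnN)
      have hn2 : ‖x‖ ≤ n := (le_max_right _ _).trans (hN.trans hnN)
      have key : ∀ g : C2b d, (∀ y ∈ ball (0 : Euc d) (2 * n + 1), g.fn y = 0) →
          (∀ y, |g.fn y| ≤ M) → T g x ≤ |C₀| * |ω n| * M := by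
        intro g hg0 hgM
        have hM0 : 0 ≤ M := (abs_nonneg _).trans (hgM x)
        refine hTq g x _ fun p t ht => ?_
        have h1 := hr n hn1 (p + t • g).fn p.fn (C2b.isC2b _) p.isC2b x hn2
        have e : (fun y => (p + t • g).fn y - p.fn y) = fun y => t * g.fn y := by
          funext y; simp
        rw [e, localC2Norm_zero (fun y hy => by rw [hg0 y hy, mul_zero]), mul_zero, zero_add] at h1
        have h2 : supNorm (fun y => t * g.fn y) ≤ t * M := by
          refine ciSup_le fun y => ?_
          rw [abs_mul, abs_of_pos ht]
          exact mul_le_mul_of_nonneg_left (hgM y) ht.le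
        have h3 : 0 ≤ supNorm (fun y => t * g.fn y) := Real.iSup_nonneg fun _ => abs_nonneg _
        calc J (p + t • g) x - J p x ≤ C₀ * ω n * supNorm (fun y => t * g.fn y) :=
              (le_abs_self _).trans h1
          _ ≤ |C₀ * ω n| * supNorm (fun y => t * g.fn y) :=
              mul_le_mul_of_nonneg_right (le_abs_self _) h3
          _ ≤ |C₀ * ω n| * (t * M) := mul_le_mul_of_nonneg_left h2 (abs_nonneg _)
          _ = t * (|C₀| * |ω n| * M) := by rw [abs_mul]; ring
      rw [hℓ, abs_le]
      refine ⟨?_, key f hf0 hfM⟩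
      have hneg : ∀ y, (-f).fn y = - f.fn y := fun y => rfl
      have := key (-f) (fun y hy => by rw [hneg, hf0 y hy, neg_zero])
        (fun y => by rw [hneg, abs_neg]; exact hfM y)
      rw [map_neg, Pi.neg_apply] at this
      linarith
    obtain ⟨D, hD1, hD2, hD3, hD4, hD5, hD6⟩ := exists_levy x ℓ hpos
      (fun n : ℕ => |C₀| * |ω n|) hω' htail
    refine ⟨D, hD1, hD2, hD3, hD4, hD5, fun w hw => ?_⟩
    rw [hL _ hw]
    exact hD6 (C2b.mk w hw)
  · rw [hL _ (hu.sub hv)]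
    rw [add_sub_cancel] at hTx
    exact hTx

end Helpers

/-- under the additional equicontinuity assumption, the min-max formula
holds with a family `ℒ` of bounded linear *operators* from `C²_b` to `C_b`, each of whose
evaluations at a point `x` is a Lévy-type functional based at `x`. -/
theorem minmax_operators (d : ℕ) (hd : 1 ≤ d) (K₀ : ℝ) (hK₀ : 0 ≤ K₀)
    (I : (Euc d → ℝ) → Euc d → ℝ)
    (hmap : ∀ u, IsC2b u → IsCb (I u))
    (hLip : LipWith K₀ IsC2b C2Norm I)
    (hGCP : GCP IsC2b I)
    (hloc : Locality IsC2b localC2Norm I)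
    (hequi : EquiContAssumption I) :
    ∃ ℒ : Set ((Euc d → ℝ) → Euc d → ℝ),
      (∀ L ∈ ℒ,
        (∀ u v, IsC2b u → IsC2b v → ∀ x : Euc d,
            L (fun y => u y + v y) x = L u x + L v x) ∧
        (∀ (c : ℝ) (u : Euc d → ℝ), IsC2b u → ∀ x : Euc d,
            L (fun y => c * u y) x = c * L u x) ∧
        (∃ K : ℝ, ∀ u, IsC2b u → ∀ x : Euc d, |L u x| ≤ K * C2Norm u) ∧
        (∀ u, IsC2b u → IsCb (L u)) ∧
        (∀ x : Euc d, ∃ D : LevyData d, D.base = x ∧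
            D.A.IsSymm ∧ D.A.PosSemidef ∧ D.μ {x} = 0 ∧
            (∫⁻ y, ENNReal.ofReal (min 1 (‖y - x‖ ^ 2)) ∂D.μ) < ⊤ ∧
            ∀ w, IsC2b w → L w x = D.apply w)) ∧
      (∀ u v, IsC2b u → IsC2b v → ∀ x : Euc d,
        ∃ L ∈ ℒ, I u x ≤ I v x + L (fun y => u y - v y) x) ∧
      (∀ u, IsC2b u → ∀ x : Euc d,
        I u x = sInf {r : ℝ | ∃ v, IsC2b v ∧
            r = sSup {s : ℝ | ∃ L ∈ ℒ, s = I v x + L (fun y => u y - v y) x}} ∧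
        sSup {s : ℝ | ∃ L ∈ ℒ, s = I u x + L (fun y => u y - u y) x} = I u x) := by
  have hii := exists_good d K₀ hK₀ I hLip hGCP hloc hequi
  refine ⟨goodOps d K₀, ?_, fun u v hu hv x => hii u v hu hv x, ?_⟩
  · rintro L ⟨h1, h2, h3, h4, h5⟩
    exact ⟨h1, h2, ⟨K₀, h3⟩, h4, h5⟩
  · intro u hu x
    have hset : {s : ℝ | ∃ L ∈ goodOps d K₀, s = I u x + L (fun y => u y - u y) x} = {I u x} := by
      have hz : ∀ L ∈ goodOps d K₀, L (fun y => u y - u y) x = 0 := by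
        rintro L ⟨-, h2, -⟩
        have := h2 0 u hu x
        simpa using this
      ext s
      constructor
      · rintro ⟨L, hL, rfl⟩
        rw [hz L hL, add_zero]
        exact mem_singleton _
      · intro hs
        obtain ⟨L, hL, -⟩ := hii u u hu hu x
        exact ⟨L, hL, by rw [hz L hL, add_zero]; exact hs⟩
    have hat : sSup {s : ℝ | ∃ L ∈ goodOps d K₀, s = I u x + L (fun y => u y - u y) x}
        = I u x := by
      rw [hset, csSup_singleton]
    refine ⟨?_, hat⟩
    have hle : ∀ r ∈ {r : ℝ | ∃ v, IsC2b v ∧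
            r = sSup {s : ℝ | ∃ L ∈ goodOps d K₀, s = I v x + L (fun y => u y - v y) x}},
        I u x ≤ r := by
      rintro r ⟨v, hv, rfl⟩
      obtain ⟨L, hL, hLe⟩ := hii u v hu hv x
      refine hLe.trans (le_csSup ?_ ⟨L, hL, rfl⟩)
      refine ⟨I v x + K₀ * C2Norm (fun y => u y - v y), ?_⟩
      rintro s ⟨L', hL', rfl⟩
      have := (le_abs_self _).trans (hL'.2.2.1 _ (hu.sub hv) x)
      linarith
    apply le_antisymm
    · exact le_csInf ⟨_, u, hu, rfl⟩ hle
    · exact csInf_le ⟨_, hle⟩ ⟨u, hu, hat.symm⟩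

end
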